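/- arXiv:2003.13152 — 2 statements merged into one kernel-verified Lean document; each statement's English description precedes it below -/
import Mathlib

section
/- Let a, b, c be positive integers and suppose p = a+b+c−1 is prime. Then the cardinality of every orbit of rowmotion Ψ acting on the set J(B_{a,b,c}) of order ideals of the poset B_{a,b,c} is a multiple of p. -/
/-- An order ideal (downward-closed subset) of a preordered set. -/
def IsOrderIdeal {α : Type*} [Preorder α] (I : Set α) : Prop :=
  ∀ ⦃x y : α⦄, x ≤ y → y ∈ I → x ∈ I

/-- Rowmotion: `Ψ(I)` is the order ideal generated by the minimal elements of
the complement of `I`, i.e. `{x | x ≤ m for some minimal element m ∉ I}`. -/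
def Rowmotion {α : Type*} [Preorder α] (I : Set α) : Set α :=
  {x | ∃ m, m ∉ I ∧ (∀ y, y < m → y ∈ I) ∧ x ≤ m}


/-- Abstract promotion system on an `a × b` rectangle. -/
structure PSys (a b q : ℕ) (T : ℕ → ℕ → ℕ → ℕ) : Prop where
  row : ∀ u i j, i + 1 < a → j < b → T u i j < T u (i+1) j
  col : ∀ u i j, i < a → j + 1 < b → T u i j < T u i (j+1)
  row2 : ∀ u i j, i + 1 < a → j < b → T (u+1) i j ≤ T u (i+1) j
  col2 : ∀ u i j, i < a → j + 1 < b → T (u+1) i j ≤ T u i (j+1)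
  lo : ∀ u i j, i < a → j < b → u < T u i j
  hi : ∀ u i j, i < a → j < b → T u i j ≤ u + q
  fwd : ∀ u i j, i < a → j < b → T u i j = T (u+1) i j ∨
    (∃ i', i = i' + 1 ∧ T u i j = T (u+1) i' j) ∨
    (∃ j', j = j' + 1 ∧ T u i j = T (u+1) i j') ∨
    (i = 0 ∧ j = 0 ∧ T u i j = u + 1)
  bwd : ∀ u i j, i < a → j < b → T (u+1) i j = T u i j ∨
    (i + 1 < a ∧ T (u+1) i j = T u (i+1) j) ∨
    (j + 1 < b ∧ T (u+1) i j = T u i (j+1)) ∨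
    (i + 1 = a ∧ j + 1 = b ∧ T (u+1) i j = u + 1 + q)

theorem PSys.transpose {a b q : ℕ} {T : ℕ → ℕ → ℕ → ℕ} (h : PSys a b q T) :
    PSys b a q (fun u i j => T u j i) where
  row u i j hi hj := h.col u j i hj hi
  col u i j hi hj := h.row u j i hj hi
  row2 u i j hi hj := h.col2 u j i hj hi
  col2 u i j hi hj := h.row2 u j i hj hi
  lo u i j hi hj := h.lo u j i hj hi
  hi u i j hi hj := h.hi u j i hj hi
  fwd u i j hi hj := by
    rcases h.fwd u j i hj hi with h1 | h1 | h1 | ⟨h1, h2, h3⟩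
    · exact Or.inl h1
    · exact Or.inr (Or.inr (Or.inl h1))
    · exact Or.inr (Or.inl h1)
    · exact Or.inr (Or.inr (Or.inr ⟨h2, h1, h3⟩))
  bwd u i j hi hj := by
    have := h.bwd u j i hj hi
    tauto

theorem PSys.col_le {a b q : ℕ} {T : ℕ → ℕ → ℕ → ℕ} (h : PSys a b q T) (u j : ℕ) (hj : j < b) :
    ∀ d i, i + d < a → T u i j ≤ T u (i+d) j := by
  intro d
  induction d with
  | zero => intro i _; exact le_rfl
  | succ d ih =>
    intro i hi
    have h1 := ih i (by omega)
    have h2 := h.row u (i+d) j (by omega) hj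
    rw [show i + (d+1) = i + d + 1 by omega]
    omega

theorem PSys.col_le' {a b q : ℕ} {T : ℕ → ℕ → ℕ → ℕ} (h : PSys a b q T) (u j : ℕ) (hj : j < b)
    (i i' : ℕ) (hii : i ≤ i') (hi : i' < a) : T u i j ≤ T u i' j := by
  obtain ⟨d, rfl⟩ := Nat.exists_eq_add_of_le hii
  exact h.col_le u j hj d i hi

/-- chains from column 0 with all values above `s`, going up-right. -/
inductive Reach (a b s : ℕ) (T : ℕ → ℕ → ℕ) : ℕ → ℕ → Prop
  | base (i : ℕ) : i < a → 0 < b → s < T i 0 → Reach a b s T 0 i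
  | step (j i₀ i : ℕ) : Reach a b s T j i₀ → i ≤ i₀ → j + 1 < b → T i₀ j < T i (j+1) →
      Reach a b s T (j+1) i

theorem Reach.lt {a b s : ℕ} {T : ℕ → ℕ → ℕ} {j i : ℕ} (h : Reach a b s T j i) :
    i < a ∧ j < b := by
  induction h with
  | base i h1 h2 h3 => exact ⟨h1, h2⟩
  | step j i₀ i h1 h2 h3 h4 ih => exact ⟨by omega, h3⟩

theorem PSys.reach_step {a b q : ℕ} {T : ℕ → ℕ → ℕ → ℕ} (h : PSys a b q T) (u s : ℕ)
    (hs : u + 1 ≤ s) {j i : ℕ} (hr : Reach a b s (T u) j i) :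
    ∃ i', (i' = i ∨ i' + 1 = i) ∧ T (u+1) i' j ≤ T u i j ∧ Reach a b s (T (u+1)) j i' := by
  induction hr with
  | base i h1 h2 h3 =>
    rcases h.fwd u i 0 h1 h2 with h4 | ⟨i', rfl, h4⟩ | ⟨j', h5, h4⟩ | ⟨_, _, h4⟩
    · exact ⟨i, Or.inl rfl, by omega, Reach.base i h1 h2 (by omega)⟩
    · exact ⟨i', Or.inr rfl, by omega, Reach.base i' (by omega) h2 (by omega)⟩
    · omega
    · omega
  | step j i₀ i h1 h2 h3 h4 ih =>
    obtain ⟨i₁, h5, h6, h7⟩ := ih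
    have hl := h1.lt
    by_cases hc : i ≤ i₁
    · rcases h.fwd u i (j+1) (by omega) h3 with h8 | ⟨i', rfl, h8⟩ | ⟨j', h9, h8⟩ | ⟨_, h8, _⟩
      · exact ⟨i, Or.inl rfl, by omega, Reach.step j i₁ i h7 hc h3 (by omega)⟩
      · exact ⟨i', Or.inr rfl, by omega, Reach.step j i₁ i' h7 (by omega) h3 (by omega)⟩
      · obtain rfl : j = j' := by omega
        have := h.col_le' (u+1) j (by omega) i i₁ hc (by omega)
        omega
      · omega
    · obtain rfl : i = i₁ + 1 := by omega
      have h8 := h.row2 u i₁ (j+1) (by omega) h3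
      have h9 := h.col (u+1) i₁ j (by omega) h3
      exact ⟨i₁, Or.inr rfl, h8, Reach.step j i₁ i₁ h7 le_rfl h3 h9⟩

/-- chains to the last column with all values at most `m`. The chain starts in the given cell. -/
inductive CoReach (a b m : ℕ) (T : ℕ → ℕ → ℕ) : ℕ → ℕ → Prop
  | base (i j : ℕ) : i < a → j + 1 = b → T i j ≤ m → CoReach a b m T j i
  | step (j i₀ i : ℕ) : CoReach a b m T (j+1) i₀ → i₀ ≤ i → i < a → T i j < T i₀ (j+1) →
      CoReach a b m T j i

theorem CoReach.lt {a b s : ℕ} {T : ℕ → ℕ → ℕ} {j i : ℕ} (h : CoReach a b s T j i) :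
    i < a ∧ j < b := by
  induction h with
  | base i j h1 h2 h3 => exact ⟨h1, by omega⟩
  | step j i₀ i h1 h2 h3 h4 ih => exact ⟨by omega, by omega⟩

theorem PSys.coreach_step {a b q : ℕ} {T : ℕ → ℕ → ℕ → ℕ} (h : PSys a b q T) (u m : ℕ)
    (hm : m ≤ u + q) {j i : ℕ} (hr : CoReach a b m (T (u+1)) j i) :
    ∃ i', (i' = i ∨ i' = i + 1) ∧ T (u+1) i j ≤ T u i' j ∧ CoReach a b m (T u) j i' := by
  induction hr with
  | base i j h1 h2 h3 =>
    rcases h.bwd u i j h1 (by omega) with h4 | ⟨h5, h4⟩ | ⟨h5, h4⟩ | ⟨_, _, h4⟩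
    · exact ⟨i, Or.inl rfl, by omega, CoReach.base i j h1 h2 (by omega)⟩
    · exact ⟨i+1, Or.inr rfl, by omega, CoReach.base (i+1) j (by omega) h2 (by omega)⟩
    · omega
    · omega
  | step j i₀ i h1 h2 h3 h4 ih =>
    obtain ⟨i₁, h5, h6, h7⟩ := ih
    have hl := h7.lt
    by_cases hc : i₁ ≤ i
    · rcases h.bwd u i j h3 (by omega) with h8 | ⟨h9, h8⟩ | ⟨h9, h8⟩ | ⟨_, h8, _⟩
      · exact ⟨i, Or.inl rfl, by omega, CoReach.step j i₁ i h7 hc h3 (by omega)⟩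
      · exact ⟨i+1, Or.inr rfl, by omega, CoReach.step j i₁ (i+1) h7 (by omega) h9 (by omega)⟩
      · have := h.col_le' u (j+1) h9 i₁ i hc (by omega)
        omega
      · omega
    · obtain rfl : i₁ = i + 1 := by omega
      have h8 := h.row2 u i j (by omega) (by omega)
      have h9 := h.col u (i+1) j (by omega) (by omega)
      exact ⟨i+1, Or.inr rfl, h8, CoReach.step j (i+1) (i+1) h7 le_rfl hl.1 h9⟩

theorem PSys.reach_iter {a b q : ℕ} {T : ℕ → ℕ → ℕ → ℕ} (h : PSys a b q T) (s m j : ℕ) (u : ℕ) :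
    ∀ d, u + d ≤ s → (∃ i, T u i j ≤ m ∧ Reach a b s (T u) j i) →
    ∃ i, T (u+d) i j ≤ m ∧ Reach a b s (T (u+d)) j i := by
  intro d
  induction d with
  | zero => intro _ h; exact h
  | succ d ih =>
    intro hd h0
    obtain ⟨i, h1, h2⟩ := ih (by omega) h0
    obtain ⟨i', _, h3, h4⟩ := h.reach_step (u+d) s (by omega) h2
    exact ⟨i', by rw [← add_assoc]; omega, h4⟩

theorem PSys.coreach_iter {a b q : ℕ} {T : ℕ → ℕ → ℕ → ℕ} (h : PSys a b q T) (s m j : ℕ) (u : ℕ)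
    (hm : m ≤ u + q) :
    ∀ d, (∃ i, s < T (u+d) i j ∧ CoReach a b m (T (u+d)) j i) →
    ∃ i, s < T u i j ∧ CoReach a b m (T u) j i := by
  intro d
  induction d with
  | zero => intro h; exact h
  | succ d ih =>
    rintro ⟨i, h1, h2⟩
    rw [← add_assoc] at h1 h2
    obtain ⟨i', _, h3, h4⟩ := h.coreach_step (u+d) m (by omega) h2
    exact ih ⟨i', by omega, h4⟩

/-- The key duality between the two off-diagonal corners. -/
theorem PSys.corner {a b q : ℕ} {T : ℕ → ℕ → ℕ → ℕ} (h : PSys (a+1) (b+1) q T) (i j : ℕ)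
    (hij : i ≤ j) : T j 0 b ≤ i + q ↔ j < T i a 0 := by
  obtain ⟨d, rfl⟩ := Nat.exists_eq_add_of_le hij
  constructor
  · intro h1
    have key : ∀ k, k ≤ b → CoReach (a+1) (b+1) (i+q) (T (i+d)) (b-k) 0 := by
      intro k
      induction k with
      | zero => intro _; exact CoReach.base 0 b (by omega) rfl h1
      | succ k ih =>
        intro hk
        refine CoReach.step _ 0 0 ?_ le_rfl (by omega) (h.col _ 0 _ (by omega) (by omega))
        rw [show b - (k+1) + 1 = b - k by omega]
        exact ih (by omega)
    have h2 := key b le_rfl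
    rw [Nat.sub_self] at h2
    obtain ⟨r, h3, h4⟩ := h.coreach_iter (i+d) (i+q) 0 i le_rfl d
      ⟨0, h.lo _ 0 0 (by omega) (by omega), h2⟩
    have h5 := h.col_le' i 0 (by omega) r a (by have := h4.lt; omega) (by omega)
    omega
  · intro h1
    have key : ∀ k, k ≤ b → Reach (a+1) (b+1) (i+d) (T i) k a := by
      intro k
      induction k with
      | zero => intro _; exact Reach.base a (by omega) (by omega) h1
      | succ k ih =>
        intro hk
        exact Reach.step k a a (ih (by omega)) le_rfl (by omega)
          (h.col _ a k (by omega) (by omega))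
    obtain ⟨r, h3, h4⟩ := h.reach_iter (i+d) (i+q) b i d le_rfl
      ⟨a, h.hi _ a b (by omega) (by omega), key b le_rfl⟩
    have h5 := h.col_le' (i+d) b (by omega) 0 r (by omega) h4.lt.1
    omega

theorem PSys.period {a b q : ℕ} {T : ℕ → ℕ → ℕ → ℕ} (h : PSys (a+1) (b+1) q T) (j : ℕ) :
    T (j+q) 0 b = T j 0 b + q := by
  have key : ∀ i, j ≤ i → i ≤ j + q → (T (j+q) 0 b ≤ i + q ↔ T j 0 b ≤ i) := by
    intro i h1 h2
    have h3 := h.corner i (j+q) h2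
    have h4 := h.transpose.corner j i h1
    omega
  have h1 := h.lo j 0 b (by omega) (by omega)
  have h2 := h.hi j 0 b (by omega) (by omega)
  have h3 := key (T j 0 b) (by omega) h2
  have h4 := key (T j 0 b - 1) (by omega) (by omega)
  omega

theorem PSys.contra {a b q : ℕ} {T : ℕ → ℕ → ℕ → ℕ} (h : PSys (a+1) (b+1) q T) (κ : ℕ)
    (hk : ∀ s, T s 0 b = s + κ) : q = a + b + 1 := by
  have h1 : ∀ k, k ≤ b → ∀ s, k ≤ s → T s 0 (b-k) + k = s + κ := by
    intro k
    induction k with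
    | zero => intro _ s _; exact hk s
    | succ k ih =>
      intro hkb s hs
      obtain ⟨s, rfl⟩ : ∃ s', s = s' + 1 := ⟨s-1, by omega⟩
      have e1 := ih (by omega) s (by omega)
      have e2 := ih (by omega) (s+1) (by omega)
      rcases h.fwd s 0 (b-k) (by omega) (by omega) with h8 | ⟨i', h9, h8⟩ | ⟨j', h9, h8⟩ | ⟨_, h8, _⟩
      · omega
      · omega
      · obtain rfl : j' = b - (k+1) := by omega
        omega
      · omega
  have h2 : ∀ k, k ≤ a → ∀ s, T s k b = s + κ + k := by
    intro k
    induction k with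
    | zero => intro _ s; exact hk s
    | succ k ih =>
      intro hka s
      have e1 := ih (by omega) s
      have e2 := ih (by omega) (s+1)
      rcases h.bwd s k b (by omega) (by omega) with h8 | ⟨h9, h8⟩ | ⟨h9, h8⟩ | ⟨_, h8, _⟩ <;> omega
  have e1 := h1 b le_rfl b le_rfl
  have e2 := h1 b le_rfl (b+1) (by omega)
  rw [Nat.sub_self] at e1 e2
  have e3 := h2 a le_rfl 0
  have e4 := h2 a le_rfl (0+1)
  have f1 := h.fwd b 0 0 (by omega) (by omega)
  have f2 := h.bwd 0 a b (by omega) (by omega)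
  have g1 : T b 0 0 = b + 1 := by
    rcases f1 with h8 | ⟨i', h9, h8⟩ | ⟨j', h9, h8⟩ | ⟨_, _, h8⟩ <;> omega
  have g2 : T (0+1) a b = 0 + 1 + q := by
    rcases f2 with h8 | ⟨h9, h8⟩ | ⟨h9, h8⟩ | ⟨_, _, h8⟩ <;> omega
  omega

/-- Height functions of a rowmotion orbit. -/
structure HSys (a b c : ℕ) (H : ℕ → ℕ → ℕ → ℕ) : Prop where
  le : ∀ t i j, H t i j ≤ c
  anti1 : ∀ t i j, H t (i+1) j ≤ H t i j
  anti2 : ∀ t i j, H t i (j+1) ≤ H t i j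
  zero1 : ∀ t i j, a ≤ i → H t i j = 0
  zero2 : ∀ t i j, b ≤ j → H t i j = 0
  s1 : ∀ t i j, H (t+1) (i+1) j ≤ H t i j
  s2 : ∀ t i j, H (t+1) i (j+1) ≤ H t i j
  fwd : ∀ t i j, i < a → j < b → H (t+1) i j = H t i j + 1 ∨
    (∃ i', i = i' + 1 ∧ H t i j = H t i' j) ∨
    (∃ j', j = j' + 1 ∧ H t i j = H t i j') ∨ H t i j = c
  bwd : ∀ t i j, i < a → j < b → H (t+1) i j = H t i j + 1 ∨
    H (t+1) i j = H (t+1) (i+1) j ∨ H (t+1) i j = H (t+1) i (j+1)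

theorem HSys.psys {a b c : ℕ} {H : ℕ → ℕ → ℕ → ℕ} (h : HSys a b c H) :
    PSys a b (a + b + c - 1) (fun u i j => u + i + j + 1 + c - H (u + i + j) i j) where
  row u i j hi hj := by
    have h1 := h.s1 (u+i+j) i j
    have h2 := h.le (u+i+j) i j
    have h3 := h.le (u+i+j+1) (i+1) j
    rw [show u + (i+1) + j = u+i+j+1 by omega]
    omega
  col u i j hi hj := by
    have h1 := h.s2 (u+i+j) i j
    have h2 := h.le (u+i+j) i j
    have h3 := h.le (u+i+j+1) i (j+1)
    rw [show u + i + (j+1) = u+i+j+1 by omega]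
    omega
  row2 u i j hi hj := by
    have h1 := h.anti1 (u+i+j+1) i j
    have h2 := h.le (u+i+j+1) i j
    rw [show u + (i+1) + j = u+i+j+1 by omega, show u + 1 + i + j = u+i+j+1 by omega]
    omega
  col2 u i j hi hj := by
    have h1 := h.anti2 (u+i+j+1) i j
    have h2 := h.le (u+i+j+1) i j
    rw [show u + i + (j+1) = u+i+j+1 by omega, show u + 1 + i + j = u+i+j+1 by omega]
    omega
  lo u i j hi hj := by
    have h2 := h.le (u+i+j) i j
    omega
  hi u i j hi hj := by
    have h2 := h.le (u+i+j) i j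
    omega
  fwd u i j hi hj := by
    have h2 := h.le (u+i+j) i j
    have h3 := h.le (u+i+j+1) i j
    have main : H (u+i+j+1) i j = H (u+i+j) i j + 1 ∨
        (∃ i', i = i' + 1 ∧ H (u+i+j) i j = H (u+i+j) i' j) ∨
        (∃ j', j = j' + 1 ∧ H (u+i+j) i j = H (u+i+j) i j') ∨
        (i = 0 ∧ j = 0 ∧ H (u+i+j) i j = c) := by
      rcases h.fwd (u+i+j) i j hi hj with h4 | h4 | h4 | h4
      · exact Or.inl h4
      · exact Or.inr (Or.inl h4)
      · exact Or.inr (Or.inr (Or.inl h4))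
      · rcases i with _ | i
        · rcases j with _ | j
          · exact Or.inr (Or.inr (Or.inr ⟨rfl, rfl, h4⟩))
          · have h5 := h.anti2 (u+0+(j+1)) 0 j
            have h6 := h.le (u+0+(j+1)) 0 j
            exact Or.inr (Or.inr (Or.inl ⟨j, rfl, by omega⟩))
        · have h5 := h.anti1 (u+(i+1)+j) i j
          have h6 := h.le (u+(i+1)+j) i j
          exact Or.inr (Or.inl ⟨i, rfl, by omega⟩)
    rcases main with h4 | ⟨i', rfl, h4⟩ | ⟨j', rfl, h4⟩ | ⟨rfl, rfl, h4⟩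
    · left
      rw [show u + 1 + i + j = u+i+j+1 by omega]
      omega
    · right; left
      refine ⟨i', rfl, ?_⟩
      rw [show u + 1 + i' + j = u + (i'+1) + j by omega]
      omega
    · right; right; left
      refine ⟨j', rfl, ?_⟩
      rw [show u + 1 + i + j' = u + i + (j'+1) by omega]
      omega
    · right; right; right
      refine ⟨rfl, rfl, ?_⟩
      omega
  bwd u i j hi hj := by
    have h2 := h.le (u+i+j) i j
    have h3 := h.le (u+i+j+1) i j
    rw [show u + (i+1) + j = u+i+j+1 by omega, show u + 1 + i + j = u+i+j+1 by omega,
      show u + i + (j+1) = u+i+j+1 by omega]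
    have a1 := h.anti1 (u+i+j+1) i j
    have a2 := h.anti2 (u+i+j+1) i j
    have z1 := h.zero1 (u+i+j+1) (i+1) j
    have z2 := h.zero2 (u+i+j+1) i (j+1)
    rcases h.bwd (u+i+j) i j hi hj with h4 | h4 | h4
    · left; omega
    · by_cases hia : i + 1 < a
      · right; left; exact ⟨hia, by omega⟩
      · have := z1 (by omega)
        by_cases hjb : j + 1 < b
        · right; right; left; exact ⟨hjb, by omega⟩
        · right; right; right; exact ⟨by omega, by omega, by omega⟩
    · by_cases hjb : j + 1 < b
      · right; right; left; exact ⟨hjb, by omega⟩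
      · have := z2 (by omega)
        by_cases hia : i + 1 < a
        · right; left; exact ⟨hia, by omega⟩
        · right; right; right; exact ⟨by omega, by omega, by omega⟩

theorem HSys.main {a b c : ℕ} {H : ℕ → ℕ → ℕ → ℕ} (h : HSys a b c H) (ha : 0 < a) (hb : 0 < b)
    (hc : 0 < c) (l : ℕ) (hl : ∀ t i j, H (t + l) i j = H t i j)
    (hcop : Nat.Coprime l (a + b + c - 1)) : False := by
  obtain ⟨a, rfl⟩ : ∃ a', a = a' + 1 := ⟨a - 1, by omega⟩
  obtain ⟨b, rfl⟩ : ∃ b', b = b' + 1 := ⟨b - 1, by omega⟩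
  have P := h.psys
  set q := a + 1 + (b + 1) + c - 1 with hq
  have h1 := P.period
  have p1 : Function.Periodic (fun s => H (s + b) 0 b) q := by
    intro s
    have e := h1 s
    have e1 := h.le (s+q+0+b) 0 b
    have e2 := h.le (s+0+b) 0 b
    simp only [add_zero] at *
    omega
  have p2 : Function.Periodic (fun s => H (s + b) 0 b) l := by
    intro s
    simp only
    rw [show s + l + b = s + b + l by omega, hl]
  have p3 : ∀ s, H (s + 1 + b) 0 b = H (s + b) 0 b := by
    have hq1 : 1 < q := by omega
    obtain ⟨m, hm⟩ := Nat.exists_mul_mod_eq_one_of_coprime hcop hq1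
    intro s
    have e1 := p2.nat_mul m s
    have e2 := p1.nat_mul (l * m / q) (s + 1)
    simp only [Nat.cast_id] at e1 e2
    have e3 := Nat.div_add_mod (l * m) q
    rw [hm.2] at e3
    rw [← e1, ← e2]
    congr 1
    have : l * m / q * q = q * (l * m / q) := mul_comm _ _
    have : m * l = l * m := mul_comm _ _
    omega
  have p4 : ∀ s, H (s + b) 0 b = H b 0 b := by
    intro s
    induction s with
    | zero => rw [zero_add]
    | succ s ih => rw [p3, ih]
  have e := P.contra (b + 1 + c - H b 0 b) (by
    intro s
    have e2 := h.le b 0 b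
    simp only [add_zero]
    rw [p4]
    omega)
  omega

theorem IsOrderIdeal.rowmotion {α : Type*} [Preorder α] (I : Set α) :
    IsOrderIdeal (Rowmotion I) := by
  rintro x y hxy ⟨m, h1, h2, h3⟩
  exact ⟨m, h1, h2, hxy.trans h3⟩

theorem rowmotion_sub {α : Type*} [PartialOrder α] [Finite α] {I J : Set α}
    (hJ : IsOrderIdeal J) (h : Rowmotion I = Rowmotion J) : J ⊆ I := by
  intro x hx
  by_contra hxI
  obtain ⟨m, hmx, hm⟩ := (Set.toFinite Iᶜ).exists_le_minimal (show x ∈ Iᶜ from hxI)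
  have hmI : ∀ y, y < m → y ∈ I := by
    intro y hy
    by_contra hyI
    exact absurd (hm.2 (show y ∈ Iᶜ from hyI) hy.le) (not_le_of_gt hy)
  have h1 : m ∈ Rowmotion I := ⟨m, hm.1, hmI, le_rfl⟩
  rw [h] at h1
  obtain ⟨m', h2, h3, h4⟩ := h1
  have h5 : m' ∈ Rowmotion J := ⟨m', h2, h3, le_rfl⟩
  rw [← h] at h5
  obtain ⟨m'', h6, h7, h8⟩ := h5
  rcases (h4.trans h8).lt_or_eq with h9 | h9
  · exact hm.1 (h7 m h9)
  · subst h9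
    have : m = m' := le_antisymm h4 h8
    subst this
    exact h2 (hJ hmx hx)

theorem rowmotion_iterate_ideal {α : Type*} [Preorder α] {I : Set α} (hI : IsOrderIdeal I)
    (n : ℕ) : IsOrderIdeal (Rowmotion^[n] I) := by
  cases n with
  | zero => exact hI
  | succ n => rw [Function.iterate_succ_apply']; exact IsOrderIdeal.rowmotion _

theorem rowmotion_periodic {α : Type*} [PartialOrder α] [Finite α] {I : Set α}
    (hI : IsOrderIdeal I) : I ∈ Function.periodicPts (Rowmotion (α := α)) := by
  have canc : ∀ m n, Rowmotion^[m] I = Rowmotion^[m + n] I → Rowmotion^[n] I = I := by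
    intro m
    induction m with
    | zero => intro n h; rw [zero_add] at h; exact h.symm
    | succ m ih =>
      intro n h
      apply ih
      rw [show m + 1 + n = m + n + 1 by omega, Function.iterate_succ_apply',
        Function.iterate_succ_apply'] at h
      exact Set.Subset.antisymm (rowmotion_sub (rowmotion_iterate_ideal hI _) h.symm)
        (rowmotion_sub (rowmotion_iterate_ideal hI _) h)
  obtain ⟨m, n, hmn, h⟩ := Finite.exists_ne_map_eq_of_infinite (fun n : ℕ => Rowmotion^[n] I)
  rcases lt_or_gt_of_ne hmn with h1 | h1
  · refine ⟨n - m, by omega, canc m (n - m) ?_⟩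
    rw [h]; congr 2; omega
  · refine ⟨m - n, by omega, canc n (m - n) ?_⟩
    rw [← h]; congr 2; omega

theorem rowmotion_orbit_card {α : Type*} [PartialOrder α] [Finite α] {I : Set α}
    (hI : IsOrderIdeal I) :
    ({J | ∃ n : ℕ, Rowmotion^[n] I = J} : Set (Set α)).ncard =
      Function.minimalPeriod Rowmotion I := by
  have hpos := Function.minimalPeriod_pos_of_mem_periodicPts (rowmotion_periodic hI)
  have : ({J | ∃ n : ℕ, Rowmotion^[n] I = J} : Set (Set α)) =
      (fun n => Rowmotion^[n] I) '' Set.Iio (Function.minimalPeriod Rowmotion I) := by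
    ext J
    constructor
    · rintro ⟨n, rfl⟩
      exact ⟨n % Function.minimalPeriod Rowmotion I, Nat.mod_lt _ hpos,
        Function.iterate_mod_minimalPeriod_eq⟩
    · rintro ⟨n, _, rfl⟩
      exact ⟨n, rfl⟩
  rw [this, Set.InjOn.ncard_image Function.iterate_injOn_Iio_minimalPeriod]
  simp [Set.ncard_eq_toFinset_card']

/-- Membership with natural-number coordinates. -/
def NMem {a b c : ℕ} (I : Set (Fin a × Fin b × Fin c)) (i j k : ℕ) : Prop :=
  ∃ (hi : i < a) (hj : j < b) (hk : k < c), ((⟨i, hi⟩, ⟨j, hj⟩, ⟨k, hk⟩) : Fin a × Fin b × Fin c) ∈ I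

theorem NMem.mono {a b c : ℕ} {I : Set (Fin a × Fin b × Fin c)} (hI : IsOrderIdeal I)
    {i j k i' j' k' : ℕ} (h : NMem I i j k) (hi : i' ≤ i) (hj : j' ≤ j) (hk : k' ≤ k) :
    NMem I i' j' k' := by
  obtain ⟨h1, h2, h3, h4⟩ := h
  exact ⟨by omega, by omega, by omega, hI (x := (⟨i', by omega⟩, ⟨j', by omega⟩, ⟨k', by omega⟩))
    (by simp [Prod.le_def, hi, hj, hk]) h4⟩

theorem nmem_rowmotion {a b c : ℕ} {I : Set (Fin a × Fin b × Fin c)} {i j k : ℕ} :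
    NMem (Rowmotion I) i j k ↔ ∃ i' j' k', i ≤ i' ∧ j ≤ j' ∧ k ≤ k' ∧ i' < a ∧ j' < b ∧ k' < c ∧
      ¬ NMem I i' j' k' ∧ ∀ x y z, x ≤ i' → y ≤ j' → z ≤ k' → (x < i' ∨ y < j' ∨ z < k') →
        NMem I x y z := by
  constructor
  · rintro ⟨h1, h2, h3, ⟨⟨i', hi'⟩, ⟨j', hj'⟩, ⟨k', hk'⟩⟩, h5, h6, h7⟩
    simp only [Prod.le_def, Fin.mk_le_mk] at h7
    refine ⟨i', j', k', h7.1, h7.2.1, h7.2.2, hi', hj', hk', fun ⟨_, _, _, h⟩ => h5 h, ?_⟩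
    intro x y z hx hy hz hlt
    refine ⟨by omega, by omega, by omega, h6 _ (lt_of_le_of_ne ?_ ?_)⟩
    · simp [Prod.le_def, hx, hy, hz]
    · simp only [ne_eq, Prod.mk.injEq, Fin.mk.injEq]
      omega
  · rintro ⟨i', j', k', hi, hj, hk, hi', hj', hk', h5, h6⟩
    refine ⟨by omega, by omega, by omega, (⟨i', hi'⟩, ⟨j', hj'⟩, ⟨k', hk'⟩),
      fun h => h5 ⟨hi', hj', hk', h⟩, ?_, by simp [Prod.le_def, hi, hj, hk]⟩
    rintro ⟨⟨x, hx⟩, ⟨y, hy⟩, ⟨z, hz⟩⟩ hlt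
    have hle := hlt.le
    have hne := hlt.ne
    simp only [Prod.le_def, Fin.mk_le_mk] at hle
    simp only [ne_eq, Prod.mk.injEq, Fin.mk.injEq] at hne
    obtain ⟨_, _, _, h⟩ := h6 x y z hle.1 hle.2.1 hle.2.2 (by omega)
    exact h

theorem exists_height {a b c : ℕ} {I : Set (Fin a × Fin b × Fin c)} (hI : IsOrderIdeal I)
    (i j : ℕ) : ∃ h, ∀ k, k < h ↔ NMem I i j k := by
  classical
  have hex : ∃ k, ¬ NMem I i j k := ⟨c, fun ⟨_, _, h, _⟩ => lt_irrefl _ h⟩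
  refine ⟨Nat.find hex, fun k => ⟨fun h => not_not.1 (Nat.find_min hex h), fun h => ?_⟩⟩
  by_contra hk
  exact Nat.find_spec hex (h.mono hI le_rfl le_rfl (by omega))

theorem exists_hsys {a b c : ℕ} {I : Set (Fin a × Fin b × Fin c)} (hI : IsOrderIdeal I) :
    ∃ H : ℕ → ℕ → ℕ → ℕ, HSys a b c H ∧
      ∀ t i j k, k < H t i j ↔ NMem (Rowmotion^[t] I) i j k := by
  have hid := rowmotion_iterate_ideal hI
  choose H hH using fun t => fun i j => exists_height (hid t) i j
  have hR : ∀ t i j k, k < H (t+1) i j ↔ NMem (Rowmotion (Rowmotion^[t] I)) i j k := by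
    intro t i j k
    rw [hH, Function.iterate_succ_apply']
  have down : ∀ t i j k i' j' k', k < H (t+1) i j → i' ≤ i → j' ≤ j → k' ≤ k →
      (i' < i ∨ j' < j ∨ k' < k) → k' < H t i' j' := by
    intro t i j k i' j' k' h h1 h2 h3 h4
    rw [hR, nmem_rowmotion] at h
    obtain ⟨x, y, z, g1, g2, g3, g4, g5, g6, g7, g8⟩ := h
    rw [hH]
    exact g8 _ _ _ (by omega) (by omega) (by omega) (by omega)
  have mono : ∀ t i j k i' j' k', k < H t i j → i' ≤ i → j' ≤ j → k' ≤ k → k' < H t i' j' := by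
    intro t i j k i' j' k' h h1 h2 h3
    rw [hH] at h ⊢
    exact h.mono (hid t) h1 h2 h3
  refine ⟨H, ?_, hH⟩
  constructor
  · intro t i j
    by_contra hlt
    obtain ⟨_, _, h, _⟩ := (hH t i j c).1 (by omega)
    exact lt_irrefl _ h
  · intro t i j
    by_contra hlt
    have := mono t (i+1) j (H t i j) i j (H t i j) (by omega) (by omega) le_rfl le_rfl
    omega
  · intro t i j
    by_contra hlt
    have := mono t i (j+1) (H t i j) i j (H t i j) (by omega) le_rfl (by omega) le_rfl
    omega
  · intro t i j hi
    by_contra hlt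
    obtain ⟨h, _, _, _⟩ := (hH t i j 0).1 (by omega)
    omega
  · intro t i j hi
    by_contra hlt
    obtain ⟨_, h, _, _⟩ := (hH t i j 0).1 (by omega)
    omega
  · intro t i j
    by_contra hlt
    have := down t (i+1) j (H t i j) i j (H t i j) (by omega) (by omega) le_rfl le_rfl (by omega)
    omega
  · intro t i j
    by_contra hlt
    have := down t i (j+1) (H t i j) i j (H t i j) (by omega) le_rfl (by omega) le_rfl (by omega)
    omega
  · intro t i j hi hj
    have hle : H (t+1) i j ≤ H t i j + 1 := by
      by_contra hlt
      have := down t i j (H t i j + 1) i j (H t i j) (by omega) le_rfl le_rfl (by omega) (by omega)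
      omega
    have hc : H t i j ≤ c := by
      by_contra hlt
      obtain ⟨_, _, h, _⟩ := (hH t i j c).1 (by omega)
      exact lt_irrefl _ h
    by_contra hcon
    simp only [not_or, not_exists, not_and] at hcon
    obtain ⟨c1, c2, c3, c4⟩ := hcon
    have : H t i j < H (t+1) i j := by
      rw [hR, nmem_rowmotion]
      refine ⟨i, j, H t i j, le_rfl, le_rfl, le_rfl, hi, hj, by omega, ?_, ?_⟩
      · rw [← hH]; exact lt_irrefl _
      · intro x y z hx hy hz hlt
        rw [← hH]
        rcases hlt with hlt | hlt | hlt
        · obtain ⟨i, rfl⟩ : ∃ i', i = i' + 1 := ⟨i - 1, by omega⟩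
          have d := c2 i rfl
          have : H t (i+1) j ≤ H t i j := by
            by_contra hlt
            have := mono t (i+1) j (H t i j) i j (H t i j) (by omega) (by omega) le_rfl le_rfl
            omega
          exact mono t i j (H t (i+1) j) x y z (by omega) (by omega) hy hz
        · obtain ⟨j, rfl⟩ : ∃ i', j = i' + 1 := ⟨j - 1, by omega⟩
          have d := c3 j rfl
          have : H t i (j+1) ≤ H t i j := by
            by_contra hlt
            have := mono t i (j+1) (H t i j) i j (H t i j) (by omega) le_rfl (by omega) le_rfl
            omega
          exact mono t i j (H t i (j+1)) x y z (by omega) hx (by omega) hz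
        · exact mono t i j z x y z hlt hx hy le_rfl
    omega
  · intro t i j hi hj
    have m1 : H (t+1) (i+1) j ≤ H (t+1) i j := by
      by_contra hlt
      have := mono (t+1) (i+1) j (H (t+1) i j) i j (H (t+1) i j) (by omega) (by omega) le_rfl le_rfl
      omega
    have m2 : H (t+1) i (j+1) ≤ H (t+1) i j := by
      by_contra hlt
      have := mono (t+1) i (j+1) (H (t+1) i j) i j (H (t+1) i j) (by omega) le_rfl (by omega) le_rfl
      omega
    rcases Nat.eq_zero_or_pos (H (t+1) i j) with h0 | h0
    · omega
    have hk : H (t+1) i j - 1 < H (t+1) i j := by omega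
    rw [hR, nmem_rowmotion] at hk
    obtain ⟨x, y, z, g1, g2, g3, g4, g5, g6, g7, g8⟩ := hk
    have hxyz : z < H (t+1) x y := by
      rw [hR, nmem_rowmotion]
      exact ⟨x, y, z, le_rfl, le_rfl, le_rfl, g4, g5, g6, g7, g8⟩
    by_cases hx : i < x
    · have := mono (t+1) x y z (i+1) j (H (t+1) i j - 1) hxyz hx g2 g3
      omega
    by_cases hy : j < y
    · have := mono (t+1) x y z i (j+1) (H (t+1) i j - 1) hxyz g1 hy g3
      omega
    obtain rfl : x = i := by omega
    obtain rfl : y = j := by omega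
    left
    rw [← hH] at g7
    rcases Nat.eq_zero_or_pos z with hz | hz
    · omega
    · have := g8 x y (z-1) le_rfl le_rfl (by omega) (by omega)
      rw [← hH] at this
      omega

/-- **Cameron–Fon-Der-Flaass conjecture.** If `p = a + b + c - 1` is prime, then the
cardinality of every Ψ-orbit of rowmotion on the order ideals of
`B_{a,b,c} = Fin a × Fin b × Fin c` is a multiple of `p`. -/
theorem rowmotion_orbit_prime_dvd (a b c : ℕ) (ha : 0 < a) (hb : 0 < b) (hc : 0 < c)
    (hp : Nat.Prime (a + b + c - 1))
    (I : Set (Fin a × Fin b × Fin c)) (hI : IsOrderIdeal I) :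
    (a + b + c - 1) ∣
      ({J | ∃ n : ℕ, Rowmotion^[n] I = J} : Set (Set (Fin a × Fin b × Fin c))).ncard := by
  rw [rowmotion_orbit_card hI]
  by_contra hnd
  obtain ⟨H, hH, hmem⟩ := exists_hsys hI
  have hper := Function.iterate_minimalPeriod (f := Rowmotion) (x := I)
  refine hH.main ha hb hc (Function.minimalPeriod Rowmotion I) ?_
    ((Nat.Prime.coprime_iff_not_dvd hp).2 hnd).symm
  intro t i j
  have key : ∀ k, k < H (t + Function.minimalPeriod Rowmotion I) i j ↔ k < H t i j := by
    intro k
    rw [hmem, hmem, Function.iterate_add_apply, hper]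
  exact le_antisymm (le_of_forall_lt fun k hk => (key k).1 hk)
    (le_of_forall_lt fun k hk => (key k).2 hk)
end

section
/- Let a, b be positive integers, let q ≥ a+b−1, let T ∈ Inc^q(a × b), and suppose the K-promotion orbit of T has cardinality k with gcd(k, q) = 1. Then q = a+b−1 and T is the minimal tableau M_{a×b}. -/
open scoped Classical

/-- Two boxes of the `a × b` grid are adjacent if they share an edge. -/
def Adj {a b : ℕ} (x y : Fin a × Fin b) : Prop :=
  (x.1 = y.1 ∧ ((x.2 : ℕ) + 1 = (y.2 : ℕ) ∨ (y.2 : ℕ) + 1 = (x.2 : ℕ))) ∨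
  (x.2 = y.2 ∧ ((x.1 : ℕ) + 1 = (y.1 : ℕ) ∨ (y.1 : ℕ) + 1 = (x.1 : ℕ)))

/-- `IncTab a b q T` says `T` is an increasing tableau of shape `a × b`
(rows strictly increase left-to-right, columns strictly increase top-to-bottom)
with positive entries, all at most `q`; i.e. `T ∈ Inc^q(a × b)`. -/
def IncTab (a b q : ℕ) (T : Fin a × Fin b → ℕ) : Prop :=
  (∀ x, 1 ≤ T x ∧ T x ≤ q) ∧
  (∀ (i : Fin a) (j₁ j₂ : Fin b), j₁ < j₂ → T (i, j₁) < T (i, j₂)) ∧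
  (∀ (i₁ i₂ : Fin a) (j : Fin b), i₁ < i₂ → T (i₁, j) < T (i₂, j))

/-- In the filling `f`, boxes `x` and `y` lie in a common edge-connected
component (short ribbon) of the set of boxes labeled `1` or `t`. -/
def SameRibbon {a b : ℕ} (t : ℕ) (f : Fin a × Fin b → ℕ) (x y : Fin a × Fin b) : Prop :=
  Relation.ReflTransGen
    (fun u v => Adj u v ∧ (f u = 1 ∨ f u = t) ∧ (f v = 1 ∨ f v = t)) x y

/-- One step of the K-promotion algorithm at value `t`: in every nontrivial
edge-connected component of the set of boxes labeled `1` or `t`, the labels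
`1` and `t` are swapped; boxes in trivial components are unchanged. -/
noncomputable def BKstep {a b : ℕ} (t : ℕ) (f : Fin a × Fin b → ℕ) :
    Fin a × Fin b → ℕ := fun x =>
  if ∃ y, y ≠ x ∧ SameRibbon t f x y then
    (if f x = 1 then t else if f x = t then 1 else f x)
  else f x

/-- The intermediate filling obtained from `f` after performing the swap steps
for the values `2, 3, …, t - 1` (so `sweepUpTo t f` is the filling in force
when the step for value `t` is about to be performed). -/
noncomputable def sweepUpTo {a b : ℕ} (t : ℕ) (f : Fin a × Fin b → ℕ) :
    Fin a × Fin b → ℕ :=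
  (List.range' 2 (t - 2)).foldl (fun g s => BKstep s g) f

/-- K-promotion `Ψ : Inc^q(a × b) → Inc^q(a × b)`: perform the swap steps for
`t = 2, …, q`, then decrement every entry by `1`, replacing a resulting `0`
by `q`. -/
noncomputable def KPro {a b : ℕ} (q : ℕ) (T : Fin a × Fin b → ℕ) :
    Fin a × Fin b → ℕ := fun x =>
  if sweepUpTo (q + 1) T x = 1 then q else sweepUpTo (q + 1) T x - 1

/-- The Ψ-orbit of `T` under K-promotion. -/
noncomputable def PsiOrbit {a b : ℕ} (q : ℕ) (T : Fin a × Fin b → ℕ) :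
    Set (Fin a × Fin b → ℕ) :=
  {U | ∃ n : ℕ, (KPro q)^[n] T = U}

/-- The pair `{x, y}` of adjacent boxes belongs to the flow path of `V`:
at the step for some value `t ∈ {2, …, q}`, both boxes carry label `1` or `t`,
so they form part of a common nontrivial short ribbon whose labels are swapped. -/
def FlowPath {a b : ℕ} (q : ℕ) (V : Fin a × Fin b → ℕ) (x y : Fin a × Fin b) : Prop :=
  Adj x y ∧ ∃ t, 2 ≤ t ∧ t ≤ q ∧
    (sweepUpTo t V x = 1 ∨ sweepUpTo t V x = t) ∧
    (sweepUpTo t V y = 1 ∨ sweepUpTo t V y = t)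

/-- The stream-bed of `V`: boxes appearing in some pair of the flow path. -/
def StreamBed {a b : ℕ} (q : ℕ) (V : Fin a × Fin b → ℕ) (x : Fin a × Fin b) : Prop :=
  ∃ y, FlowPath q V x y ∨ FlowPath q V y x

/-- The box `x` lies in the frame of the `a × b` grid (first or last row,
or first or last column). -/
def InFrame {a b : ℕ} (x : Fin a × Fin b) : Prop :=
  (x.1 : ℕ) = 0 ∨ (x.1 : ℕ) = a - 1 ∨ (x.2 : ℕ) = 0 ∨ (x.2 : ℕ) = b - 1

/-- `Frame(V) = Frame(W)`: the fillings agree on all frame boxes. -/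
def FrameEq {a b : ℕ} (V W : Fin a × Fin b → ℕ) : Prop :=
  ∀ x, InFrame x → V x = W x

/-- The minimal tableau `M_{a×b}`, with entries `M(i,j) = i + j - 1`
(in 1-based coordinates; here coordinates are 0-based). -/
def MinTab (a b : ℕ) : Fin a × Fin b → ℕ := fun x => (x.1 : ℕ) + (x.2 : ℕ) + 1


/-- Local rule of the K-growth diagram, in terms of row lengths. -/
structure LR (l m n p : ℕ → ℕ) : Prop where
  lm : ∀ r, l r ≤ m r ∧ m r ≤ l r + 1
  ln : ∀ r, l r ≤ n r ∧ n r ≤ l r + 1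
  mp : ∀ r, m r ≤ p r ∧ p r ≤ m r + 1
  np : ∀ r, n r ≤ p r ∧ p r ≤ n r + 1
  vlm : ∀ r, m (r+1) ≤ l r
  vln : ∀ r, n (r+1) ≤ l r
  vmp : ∀ r, p (r+1) ≤ m r
  vnp : ∀ r, p (r+1) ≤ n r
  r1 : ∀ r, p r = l r + 1 → m r = p r → n r = p r → p (r+1) = p r
  r2 : ∀ r, p r = l r + 1 → m r = l r → n r = l r → ∃ s, r = s + 1 ∧ l s = l r

theorem LR.symm {l m n p : ℕ → ℕ} (h : LR l m n p) : LR l n m p :=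
  ⟨h.ln, h.lm, h.np, h.mp, h.vln, h.vlm, h.vnp, h.vmp,
   fun r h1 h2 h3 => h.r1 r h1 h3 h2, fun r h1 h2 h3 => h.r2 r h1 h3 h2⟩

theorem LR.det {l m n n' p : ℕ → ℕ} (h : LR l m n p) (h' : LR l m n' p) : n = n' := by
  have key : ∀ {n n' : ℕ → ℕ}, LR l m n p → LR l m n' p → ∀ r, n r ≤ n' r := by
    intro n n' h h' r
    by_contra hlt
    have a1 := h.ln r; have a2 := h'.ln r; have a3 := h.np r; have a4 := h'.np r
    have a5 := h.lm r; have a6 := h.mp r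
    have a7 := h'.vnp r
    by_cases hm : m r = l r
    · obtain ⟨s, rfl, hs⟩ := h'.r2 r (by omega) hm (by omega)
      have := h.vln s
      omega
    · have := h.r1 r (by omega) (by omega) (by omega)
      omega
  funext r
  exact le_antisymm (key h h' r) (key h' h r)

/-- Last passage time. -/
def LP (a : ℕ) (h : ℕ → ℕ → ℕ) : ℕ → ℕ → ℕ
  | 0, _ => 0
  | t+1, r => (Finset.Ico r a).sup (fun s => LP a h t s + (h (t+1) s - h t s))

theorem LP_ge (a : ℕ) (h : ℕ → ℕ → ℕ) (t r : ℕ) (hr : a ≤ r) : LP a h t r = 0 := by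
  cases t with
  | zero => rfl
  | succ t => simp [LP, Finset.Ico_eq_empty_of_le hr]

theorem LP_succ (a : ℕ) (h : ℕ → ℕ → ℕ) (t r : ℕ) (hz : ∀ t r, a ≤ r → h t r = 0) :
    LP a h (t+1) r = max (LP a h (t+1) (r+1)) (LP a h t r + (h (t+1) r - h t r)) := by
  by_cases hr : r < a
  · have : Finset.Ico r a = insert r (Finset.Ico (r+1) a) := by
      ext x; simp; omega
    conv_lhs => rw [LP, this, Finset.sup_insert]
    rw [max_comm]; rfl
  · rw [LP_ge _ _ _ _ (by omega), LP_ge _ _ _ _ (by omega), LP_ge _ _ _ _ (by omega), hz _ _ (by omega)]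
    simp

theorem step_core (a : ℕ) (l m n p fa fb ga gb : ℕ → ℕ) (h : LR l m n p)
    (hga : ∀ r, ga r = max (ga (r+1)) (fa r + (p r - m r)))
    (hgb : ∀ r, gb r = max (gb (r+1)) (fb r + (n r - l r)))
    (za : ∀ r, a ≤ r → ga r = 0) (zb : ∀ r, a ≤ r → gb r = 0)
    (i1 : ∀ r, fb r ≤ fa r ∧ fa r + l r ≤ fb r + m r)
    (i2 : ∀ r, fa (r+1) = fb (r+1) + 1 → fb r + l (r+1) = fb (r+1) + l r)
    (i4 : ∀ r, m (r+1) = l (r+1) + 1 → fb r + l (r+1) = fb (r+1) + l r → fa (r+1) = fb (r+1) + 1)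
    (i3 : fa 0 = fb 0) (mono : ∀ r, fb (r+1) ≤ fb r)
    (pu : ∀ r, fb r + l (r+1) ≤ fb (r+1) + l r) 
    (pu' : ∀ r, gb r + n (r+1) ≤ gb (r+1) + n r) :
    (∀ r, gb r ≤ ga r ∧ ga r + n r ≤ gb r + p r) ∧
    (∀ r, ga (r+1) = gb (r+1) + 1 → gb r + n (r+1) = gb (r+1) + n r) ∧
    (∀ r, p (r+1) = n (r+1) + 1 → gb r + n (r+1) = gb (r+1) + n r → ga (r+1) = gb (r+1) + 1) ∧
    ga 0 = gb 0 := by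
  have LL : ∀ r, m r = l r + 1 → p r = n r + 1 →
      (gb (r+1) ≤ ga (r+1) ∧ ga (r+1) + n (r+1) ≤ gb (r+1) + p (r+1)) →
      (ga (r+1) = gb (r+1) + 1 → gb r + n (r+1) = gb (r+1) + n r) →
      ga r = gb r + 1 → fa r = fb r + 1 ∧ gb r + l r = fb r + n r := by
    intro r h1 h2 h3 h4 h5
    have a1 := hga r; have a2 := hgb r
    have a3 := i1 r; have a4 := h.vnp r
    have a5 := h.np (r+1)
    have a6 := h.lm r
    have a7 := h.ln r
    have a8 := h.mp r
    omega
  have Q : ∀ k r, a ≤ r + k → (gb r ≤ ga r ∧ ga r + n r ≤ gb r + p r) ∧ 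
      (ga (r+1) = gb (r+1) + 1 → gb r + n (r+1) = gb (r+1) + n r) := by
    intro k
    induction k with
    | zero =>
      intro r hr
      rw [za r (by omega), zb r (by omega), za (r+1) (by omega), zb (r+1) (by omega)]
      have := h.np r
      omega
    | succ k ih =>
      intro r hr
      obtain ⟨q1, q2⟩ := ih (r+1) (by omega)
      obtain ⟨q3, -⟩ := ih (r+1+1) (by omega)
      have L1 := LL (r+1)
      have a1 := hga r; have a2 := hgb r
      have a1' := hga (r+1); have a2' := hgb (r+1)
      have b1 := i1 r; have b2 := i1 (r+1)
      have b3 := i2 r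
      have b4 := pu r
      have b5 := pu' r
      have b5' := pu' (r+1)
      have c1 := h.lm r; have c2 := h.ln r; have c3 := h.mp r; have c4 := h.np r
      have c1' := h.lm (r+1); have c2' := h.ln (r+1); have c3' := h.mp (r+1); have c4' := h.np (r+1)
      have d1 := h.vlm r; have d2 := h.vln r; have d3 := h.vmp r; have d4 := h.vnp r
      have d4' := h.vnp (r+1)
      have e1 := h.r1 r
      have e1' := h.r1 (r+1)
      have e2 : p (r+1) = l (r+1) + 1 → m (r+1) = l (r+1) → n (r+1) = l (r+1) → l r = l (r+1) := by
        intro x y z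
        obtain ⟨s, hs, hs'⟩ := h.r2 (r+1) x y z
        have : s = r := by omega
        subst this; exact hs'
      have tight : ga (r+1) = gb (r+1) + 1 → gb r + n (r+1) = gb (r+1) + n r := by
        intro hd
        clear e1 hga hgb za zb i1 i2 i3 pu pu' LL ih
        have : m (r+1) = l (r+1) + 1 ∨ m (r+1) = l (r+1) := by omega
        rcases this with hm | hm
        · have L2 := L1 hm (by omega) q3 q2 hd
          obtain ⟨L2, L3⟩ := L2
          have b3 := b3 L2
          clear L1
          omega
        · clear L1
          have : n (r+1) = l (r+1) := by omega
          have e2 := e2 (by omega) hm this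
          have mo := mono r
          omega
      refine ⟨?_, tight⟩
      clear hga hgb za zb i1 i2 i3 pu pu' LL ih L1 q2 q3 a2' mono b3 b5 b5' d4' e1' e2
      have i4 := i4 r
      have D : ga (r+1) = gb (r+1) ∨ ga (r+1) = gb (r+1) + 1 := by omega
      have M : m r = l r + 1 ∨ m r = l r := by omega
      have W : p r = m r + 1 ∨ p r = m r := by omega
      have N : n r = l r + 1 ∨ n r = l r := by omega
      have A1 : ga (r+1) ≥ fa (r+1) + (p (r+1) - m (r+1)) := by omega
      clear a1'
      rcases D with D | D
      · clear tight
        rcases M with M | M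
        · rcases W with W | W
          · clear e1 i4 A1
            omega
          · rcases N with N | N
            · have e1 := e1 (by omega) (by omega) (by omega)
              have : ga (r+1) ≥ fb r + 1 ∨ fa r = fb r + 1 := by
                clear a1 a2
                by_cases hl : l (r+1) = l r
                · omega
                · by_cases ht : fb r + l (r+1) = fb (r+1) + l r
                  · have := i4 (by omega) ht
                    omega
                  · omega
              clear i4 A1 b2 b4
              omega
            · clear e1 i4 A1
              omega
        · clear e1 i4 A1 b2 b4
          omega
      · have tight := tight D
        clear b2 b4 A1 i4
        rcases M with M | M
        · rcases W with W | W
          · clear e1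
            omega
          · rcases N with N | N
            · have e1 := e1 (by omega) (by omega) (by omega)
              omega
            · clear e1
              omega
        · clear e1
          omega
  have C : ∀ r, p (r+1) = n (r+1) + 1 → gb r + n (r+1) = gb (r+1) + n r →
      ga (r+1) = gb (r+1) + 1 := by
    intro r h1 h2
    have q1 := (Q a (r+1) (by omega)).1
    have a2 := hgb r
    have a1' := hga (r+1); have a2' := hgb (r+1)
    have b2 := i1 (r+1)
    have b4 := pu r
    have i4 := i4 r
    have c2 := h.ln r
    have c1' := h.lm (r+1); have c2' := h.ln (r+1); have c3' := h.mp (r+1); have c4' := h.np (r+1)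
    have d4 := h.vnp r
    have u1 : gb r + l r = fb r + n r := by omega
    by_cases hm : m (r+1) = l (r+1)
    · obtain ⟨s, hs, hs'⟩ := h.r2 (r+1) (by omega) hm (by omega)
      have : s = r := by omega
      subst this
      omega
    · have := i4 (by omega) (by omega)
      omega
  refine ⟨fun r => (Q a r (by omega)).1, fun r => (Q a r (by omega)).2, C, ?_⟩
  have q1 := (Q a 0 (by omega)).1
  have q2 := (Q a 0 (by omega)).2
  have q3 := (Q a 1 (by omega)).1
  have L1 := LL 0
  have c1 := h.lm 0; have c2 := h.ln 0; have c3 := h.mp 0; have c4 := h.np 0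
  have e2 : ¬ (p 0 = l 0 + 1 ∧ m 0 = l 0 ∧ n 0 = l 0) := by
    rintro ⟨x, y, z⟩
    obtain ⟨s, hs, hs'⟩ := h.r2 0 x y z
    omega
  have a1 := hga 0; have a2 := hgb 0
  by_contra hne
  have := L1 (by omega) (by omega) q3 q2 (by omega)
  omega

theorem LP_mono (a : ℕ) (h : ℕ → ℕ → ℕ) (t r : ℕ) (hz : ∀ t r, a ≤ r → h t r = 0) :
    LP a h t (r+1) ≤ LP a h t r := by
  cases t with
  | zero => exact le_refl _
  | succ t => rw [LP_succ a h t r hz]; exact le_max_left _ _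

theorem LP_push (a : ℕ) (h : ℕ → ℕ → ℕ) (hz : ∀ t r, a ≤ r → h t r = 0) (m : ℕ)
    (hm : ∀ t < m, ∀ r, h t r ≤ h (t+1) r) (hv : ∀ t ≤ m, ∀ r, h t (r+1) ≤ h t r) :
    ∀ t ≤ m, ∀ r, LP a h t r + h t (r+1) ≤ LP a h t (r+1) + h t r := by
  intro t
  induction t with
  | zero => intro ht r; have := hv 0 ht r; simp only [LP]; omega
  | succ t ih =>
    intro ht r
    have h1 := ih (by omega) r
    have h2 := LP_succ a h t r hz
    have h3 := LP_succ a h t (r+1) hz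
    have h4 := hm t (by omega) r
    have h5 := hm t (by omega) (r+1)
    have h6 := hv (t+1) ht r
    omega

theorem chain_inv (a m : ℕ) (A B : ℕ → ℕ → ℕ)
    (zA : ∀ t r, a ≤ r → A t r = 0) (zB : ∀ t r, a ≤ r → B t r = 0)
    (hv : ∀ r, B 0 r ≤ A 0 r ∧ A 0 (r+1) ≤ B 0 r)
    (h : ∀ t < m, LR (B t) (A t) (B (t+1)) (A (t+1))) :
    LP a A m 0 = LP a B m 0 := by
  have hB1 : ∀ t < m, ∀ r, B t r ≤ B (t+1) r := fun t ht r => ((h t ht).ln r).1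
  have hB2 : ∀ t ≤ m, ∀ r, B t (r+1) ≤ B t r := by
    intro t ht r
    cases t with
    | zero => have := hv r; have := hv (r+1); omega
    | succ t => exact ((h t (by omega)).np (r+1)).1.trans ((h t (by omega)).vnp r)
  have pu := LP_push a B zB m hB1 hB2
  have key : ∀ t ≤ m,
      (∀ r, LP a B t r ≤ LP a A t r ∧ LP a A t r + B t r ≤ LP a B t r + A t r) ∧
      (∀ r, LP a A t (r+1) = LP a B t (r+1) + 1 →
        LP a B t r + B t (r+1) = LP a B t (r+1) + B t r) ∧
      (∀ r, A t (r+1) = B t (r+1) + 1 →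
        LP a B t r + B t (r+1) = LP a B t (r+1) + B t r → LP a A t (r+1) = LP a B t (r+1) + 1) ∧
      LP a A t 0 = LP a B t 0 := by
    intro t
    induction t with
    | zero =>
      intro _
      simp only [LP]
      refine ⟨fun r => ?_, fun r => ?_, fun r => ?_, ?_⟩
      all_goals first | (have := hv r; have := hv (r+1); omega) | trivial
    | succ t ih =>
      intro ht
      obtain ⟨i1, i2, i4, i3⟩ := ih (by omega)
      exact step_core a _ _ _ _ _ _ _ _ (h t (by omega)) (fun r => LP_succ a A t r zA)
        (fun r => LP_succ a B t r zB) (fun r hr => LP_ge a A _ r hr) (fun r hr => LP_ge a B _ r hr)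
        i1 i2 i4 i3 (fun r => LP_mono a B t r zB) (pu t (by omega)) (pu (t+1) ht)
  exact (key m le_rfl).2.2.2

theorem LP_straight (a : ℕ) (h : ℕ → ℕ → ℕ) (hz : ∀ t r, a ≤ r → h t r = 0) (m : ℕ)
    (h0 : ∀ r, h 0 r = 0)
    (hm : ∀ t < m, ∀ r, h t r ≤ h (t+1) r) (hv : ∀ t ≤ m, ∀ r, h t (r+1) ≤ h t r) :
    ∀ t ≤ m, ∀ r, LP a h t r = h t r := by
  intro t
  induction t with
  | zero => intro _ r; simp [LP, h0]
  | succ t ih =>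
    intro ht
    have key : ∀ k r, a ≤ r + k → LP a h (t+1) r = h (t+1) r := by
      intro k
      induction k with
      | zero => intro r hr; rw [LP_ge _ _ _ _ (by omega), hz _ _ (by omega)]
      | succ k ihk =>
        intro r hr
        rw [LP_succ a h t r hz, ihk (r+1) (by omega), ih (by omega) r]
        have h4 := hm t (by omega) r
        have h6 := hv (t+1) ht r
        omega
    intro r
    exact key a r (by omega)

theorem LP_rect (a : ℕ) (ha : 0 < a) (h : ℕ → ℕ → ℕ) (hz : ∀ t r, a ≤ r → h t r = 0) (m b : ℕ)
    (h0 : ∀ r < a, h m r = b)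
    (hm : ∀ t < m, ∀ r, h t r ≤ h (t+1) r) (hv : ∀ t ≤ m, ∀ r, h t (r+1) ≤ h t r) :
    LP a h m 0 + h 0 (a-1) = b := by
  have pu := LP_push a h hz m hm hv m le_rfl
  have e1 : ∀ k < a, LP a h m 0 = LP a h m k := by
    intro k
    induction k with
    | zero => intro _; rfl
    | succ k ih =>
      intro hk
      have := pu k
      have h3 := LP_mono a h m k hz
      rw [h0 k (by omega), h0 (k+1) hk] at this
      rw [ih (by omega)]
      omega
  rw [e1 (a-1) (by omega)]
  have e2 : ∀ t ≤ m, LP a h t (a-1) + h 0 (a-1) = h t (a-1) := by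
    intro t
    induction t with
    | zero => intro _; simp [LP]
    | succ t ih =>
      intro ht
      have := ih (by omega)
      have h4 := hm t (by omega) (a-1)
      rw [LP_succ a h t (a-1) hz, LP_ge a h (t+1) (a-1+1) (by omega)]
      omega
  rw [e2 m le_rfl, h0 (a-1) (by omega)]

structure Tri (a b q : ℕ) (H : ℕ → ℕ → ℕ → ℕ) : Prop where
  z : ∀ i j r, a ≤ r → H i j r = 0
  diag : ∀ i r, i ≤ q → H i i r = 0
  full : ∀ r < a, H 0 q r = b
  mono : ∀ i j r, i ≤ j → j < q → H i j r ≤ H i (j+1) r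
  mono' : ∀ i j r, i < j → j ≤ q → H (i+1) j r ≤ H i j r
  anti : ∀ i j r, i ≤ j → j ≤ q → H i j (r+1) ≤ H i j r
  vert : ∀ i j r, i < j → j ≤ q → H i j (r+1) ≤ H (i+1) j r
  vert' : ∀ i j r, i ≤ j → j < q → H i (j+1) (r+1) ≤ H i j r
  lr : ∀ i j, i < j → j < q → LR (H (i+1) j) (H i j) (H (i+1) (j+1)) (H i (j+1))

theorem Tri.refl {a b q : ℕ} {H : ℕ → ℕ → ℕ → ℕ} (h : Tri a b q H) :
    Tri a b q (fun i j => if i ≤ q ∧ j ≤ q then H (q-j) (q-i) else fun _ => 0) where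
  z i j r hr := by
    split
    · exact h.z _ _ _ hr
    · rfl
  diag i r hi := by
    rw [if_pos ⟨hi, hi⟩]
    exact h.diag _ _ (by omega)
  full r hr := by
    rw [if_pos ⟨by omega, by omega⟩]
    simpa using h.full r hr
  mono i j r h1 h2 := by
    rw [if_pos ⟨by omega, by omega⟩, if_pos ⟨by omega, by omega⟩]
    have := h.mono' (q-(j+1)) (q-i) r (by omega) (by omega)
    rwa [show q - (j+1) + 1 = q - j by omega] at this
  mono' i j r h1 h2 := by
    rw [if_pos ⟨by omega, by omega⟩, if_pos ⟨by omega, by omega⟩]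
    have := h.mono (q-j) (q-(i+1)) r (by omega) (by omega)
    rwa [show q - (i+1) + 1 = q - i by omega] at this
  anti i j r h1 h2 := by
    rw [if_pos ⟨by omega, by omega⟩]
    exact h.anti _ _ _ (by omega) (by omega)
  vert i j r h1 h2 := by
    rw [if_pos ⟨by omega, by omega⟩, if_pos ⟨by omega, by omega⟩]
    have := h.vert' (q-j) (q-(i+1)) r (by omega) (by omega)
    rwa [show q - (i+1) + 1 = q - i by omega] at this
  vert' i j r h1 h2 := by
    rw [if_pos ⟨by omega, by omega⟩, if_pos ⟨by omega, by omega⟩]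
    have := h.vert (q-(j+1)) (q-i) r (by omega) (by omega)
    rwa [show q - (j+1) + 1 = q - j by omega] at this
  lr i j h1 h2 := by
    rw [if_pos ⟨by omega, by omega⟩, if_pos ⟨by omega, by omega⟩, if_pos ⟨by omega, by omega⟩,
      if_pos ⟨by omega, by omega⟩]
    have := (h.lr (q-(j+1)) (q-(i+1)) (by omega) (by omega)).symm
    rwa [show q - (i+1) + 1 = q - i by omega, show q - (j+1) + 1 = q - j by omega] at this

theorem Tri.A {a b q : ℕ} {H : ℕ → ℕ → ℕ → ℕ} (ha : 0 < a) (h : Tri a b q H) (i : ℕ) (hi : i ≤ q) :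
    H i q 0 + H 0 i (a-1) = b := by
  have e : ∀ k ≤ i, LP a (fun t => H 0 (i+t)) (q-i) 0 = LP a (fun t => H k (i+t)) (q-i) 0 := by
    intro k
    induction k with
    | zero => intro _; rfl
    | succ k ih =>
      intro hk
      rw [ih (by omega)]
      refine chain_inv a (q-i) _ _ (fun t r hr => h.z _ _ _ hr) (fun t r hr => h.z _ _ _ hr) ?_ ?_
      · intro r
        exact ⟨h.mono' k (i+0) r (by omega) (by omega), h.vert k (i+0) r (by omega) (by omega)⟩
      · intro t ht
        exact h.lr k (i+t) (by omega) (by omega)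
  have e1 := LP_rect a ha (fun t => H 0 (i+t)) (fun t r hr => h.z _ _ _ hr) (q-i) b
    (fun r hr => by
      show H 0 (i+(q-i)) r = b
      rw [show i + (q-i) = q by omega]; exact h.full r hr)
    (fun t ht r => h.mono 0 (i+t) r (by omega) (by omega))
    (fun t ht r => h.anti 0 (i+t) r (by omega) (by omega))
  have e2 := LP_straight a (fun t => H i (i+t)) (fun t r hr => h.z _ _ _ hr) (q-i)
    (fun r => h.diag i r hi)
    (fun t ht r => h.mono i (i+t) r (by omega) (by omega))
    (fun t ht r => h.anti i (i+t) r (by omega) (by omega)) (q-i) le_rfl 0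
  rw [e i le_rfl, e2] at e1
  simp only [show i + (q-i) = q by omega] at e1
  exact e1

theorem Tri.B {a b q : ℕ} {H : ℕ → ℕ → ℕ → ℕ} (ha : 0 < a) (h : Tri a b q H) (i : ℕ) (hi : i ≤ q) :
    H 0 i 0 + H i q (a-1) = b := by
  have := h.refl.A ha (q-i) (by omega)
  simp only [Nat.sub_self, Nat.sub_zero, Nat.sub_le, le_refl, Nat.zero_le, and_self, if_true] at this
  rwa [show q - (q-i) = i by omega] at this

def Cov {a b : ℕ} (x y : Fin a × Fin b) : Prop :=
  (x.1 = y.1 ∧ (x.2 : ℕ) + 1 = y.2) ∨ (x.2 = y.2 ∧ (x.1 : ℕ) + 1 = y.1)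

theorem adj_iff {a b : ℕ} (x y : Fin a × Fin b) : Adj x y ↔ Cov x y ∨ Cov y x := by
  unfold Adj Cov
  rw [eq_comm (a := y.1), eq_comm (a := y.2)]
  tauto

theorem IncTab.cov {a b q : ℕ} {T : Fin a × Fin b → ℕ} (h : IncTab a b q T) (x y : Fin a × Fin b)
    (hxy : Cov x y) : T x < T y := by
  obtain ⟨x1, x2⟩ := x
  obtain ⟨y1, y2⟩ := y
  rcases hxy with ⟨h1, h2⟩ | ⟨h1, h2⟩
  · simp only at h1 h2; subst h1
    exact h.2.1 _ _ _ (by rw [Fin.lt_def]; omega)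
  · simp only at h1 h2; subst h1
    exact h.2.2 _ _ _ (by rw [Fin.lt_def]; omega)

theorem IncTab.of_cov {a b q : ℕ} {T : Fin a × Fin b → ℕ} (h0 : ∀ x, 1 ≤ T x ∧ T x ≤ q)
    (h : ∀ x y, Cov x y → T x < T y) : IncTab a b q T := by
  refine ⟨h0, ?_, ?_⟩
  · intro i j₁ j₂ hj
    have key : ∀ k : ℕ, ∀ hk : (j₁ : ℕ) + k + 1 < b, T (i, j₁) < T (i, ⟨j₁ + k + 1, hk⟩) := by
      intro k
      induction k with
      | zero => intro hk; exact h _ _ (Or.inl ⟨rfl, rfl⟩)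
      | succ k ih =>
        intro hk
        exact (ih (by omega)).trans (h _ _ (Or.inl ⟨rfl, by simp only; omega⟩))
    have h1 := key (j₂ - j₁ - 1) (by have := j₂.2; rw [Fin.lt_def] at hj; omega)
    have : (⟨j₁ + (j₂ - j₁ - 1) + 1, by have := j₂.2; rw [Fin.lt_def] at hj; omega⟩ : Fin b) = j₂ := by
      ext; simp only; rw [Fin.lt_def] at hj; omega
    rwa [this] at h1
  · intro j₁ j₂ i hj
    have key : ∀ k : ℕ, ∀ hk : (j₁ : ℕ) + k + 1 < a, T (j₁, i) < T (⟨j₁ + k + 1, hk⟩, i) := by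
      intro k
      induction k with
      | zero => intro hk; exact h _ _ (Or.inr ⟨rfl, rfl⟩)
      | succ k ih =>
        intro hk
        exact (ih (by omega)).trans (h _ _ (Or.inr ⟨rfl, by simp only; omega⟩))
    have h1 := key (j₂ - j₁ - 1) (by have := j₂.2; rw [Fin.lt_def] at hj; omega)
    have : (⟨j₁ + (j₂ - j₁ - 1) + 1, by have := j₂.2; rw [Fin.lt_def] at hj; omega⟩ : Fin a) = j₂ := by
      ext; simp only; rw [Fin.lt_def] at hj; omega
    rwa [this] at h1

/-- Sweep invariant. -/
structure SI {a b : ℕ} (T : Fin a × Fin b → ℕ) (t : ℕ) (g : Fin a × Fin b → ℕ) : Prop where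
  s0 : ∀ x, t ≤ T x → g x = T x
  s1 : ∀ x, T x < t → 1 ≤ g x ∧ g x < t
  s2 : ∀ x y, Cov x y → (g x ≠ 1 → g y ≠ 1 → g x < g y) ∧ (g x = 1 → t ≤ g y) ∧ (g y = 1 → g x < t)
  p1 : ∀ x, g x ≠ 1 → T x ≤ g x
  p2 : ∀ x y, Cov x y → T y < t → g x ≠ 1 ∧ g x ≤ T y
  p3 : ∀ x, g x ≠ 1 → g x < t → T x < g x → ∃ y, Cov x y ∧ T y = g x
  p4 : ∀ x, 2 ≤ T x → T x < t → (g x = 1 ∨ T x < g x) → ∃ y, Cov y x ∧ g y = T x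

theorem ribbon_iff {a b : ℕ} (t : ℕ) (g : Fin a × Fin b → ℕ) (x : Fin a × Fin b) :
    (∃ y, y ≠ x ∧ SameRibbon t g x y) ↔
      (g x = 1 ∨ g x = t) ∧ ∃ y, (Cov x y ∨ Cov y x) ∧ (g y = 1 ∨ g y = t) := by
  constructor
  · rintro ⟨y, hne, hr⟩
    rcases Relation.ReflTransGen.cases_head hr with h | ⟨z, ⟨h1, h2, h3⟩, -⟩
    · exact absurd h.symm hne
    · exact ⟨h2, z, (adj_iff _ _).1 h1, h3⟩
  · rintro ⟨h1, y, h2, h3⟩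
    refine ⟨y, ?_, Relation.ReflTransGen.single ⟨(adj_iff _ _).2 h2, h1, h3⟩⟩
    rintro rfl
    unfold Cov at h2
    omega

theorem SI.step_val {a b : ℕ} {T : Fin a × Fin b → ℕ} {t : ℕ} (ht : 2 ≤ t) {g : Fin a × Fin b → ℕ}
    (h : SI T t g) (x : Fin a × Fin b) :
    (g x = 1 ∧ BKstep t g x = t ∧ ∃ y, Cov x y ∧ g y = t) ∨
    (g x = t ∧ BKstep t g x = 1 ∧ ∃ y, Cov y x ∧ g y = 1) ∨
    (BKstep t g x = g x ∧ (g x = 1 → ∀ y, Cov x y → g y ≠ t) ∧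
      (g x = t → ∀ y, Cov y x → g y ≠ 1)) := by
  by_cases hx : ∃ y, y ≠ x ∧ SameRibbon t g x y
  · have hv : BKstep t g x = (if g x = 1 then t else if g x = t then 1 else g x) := if_pos hx
    rw [ribbon_iff] at hx
    obtain ⟨h1, y, hy, h2⟩ := hx
    rcases h1 with h1 | h1
    · left
      refine ⟨h1, by rw [hv, if_pos h1], y, ?_⟩
      rcases hy with hy | hy
      · have := h.s2 _ _ hy
        exact ⟨hy, by omega⟩
      · have := h.s2 _ _ hy
        omega
    · right; left
      refine ⟨h1, by rw [hv, if_neg (by omega), if_pos h1], y, ?_⟩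
      rcases hy with hy | hy
      · have := h.s2 _ _ hy
        omega
      · have := h.s2 _ _ hy
        exact ⟨hy, by omega⟩
  · right; right
    refine ⟨if_neg hx, ?_, ?_⟩
    · intro h1 y hy h2
      exact hx ((ribbon_iff _ _ _).2 ⟨Or.inl h1, y, Or.inl hy, Or.inr h2⟩)
    · intro h1 y hy h2
      exact hx ((ribbon_iff _ _ _).2 ⟨Or.inr h1, y, Or.inr hy, Or.inl h2⟩)

theorem SI.step {a b q : ℕ} {T : Fin a × Fin b → ℕ} (hT : IncTab a b q T) {t : ℕ} (ht : 2 ≤ t)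
    {g : Fin a × Fin b → ℕ} (h : SI T t g) : SI T (t+1) (BKstep t g) := by
  have gt : ∀ x, g x = t → T x = t := by
    intro x hx
    have := h.s0 x; have := h.s1 x; omega
  have V := h.step_val ht
  constructor
  · intro x hx
    have := h.s0 x (by omega)
    rcases V x with ⟨v1, v2, v3⟩ | ⟨v1, v2, v3⟩ | ⟨v1, v2, v3⟩ <;> omega
  · intro x hx
    have := h.s0 x
    have := h.s1 x
    rcases V x with ⟨v1, v2, v3⟩ | ⟨v1, v2, v3⟩ | ⟨v1, v2, v3⟩ <;> omega
  · intro x y hxy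
    obtain ⟨u1, u2, u3⟩ := h.s2 x y hxy
    rcases V x with ⟨v1, v2, -⟩ | ⟨v1, v2, -⟩ | ⟨v1, v2, -⟩
    · have u2 := u2 v1
      rcases V y with ⟨w1, w2, -⟩ | ⟨w1, w2, -⟩ | ⟨w1, -, w3⟩
      · omega
      · omega
      · have w3' := fun hh => w3 hh x hxy
        omega
    · rcases V y with ⟨w1, w2, -⟩ | ⟨w1, w2, -⟩ | ⟨w1, -, -⟩ <;> omega
    · have v2 := fun hh => v2 hh y hxy
      rcases V y with ⟨w1, w2, -⟩ | ⟨w1, w2, -⟩ | ⟨w1, -, -⟩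
      · omega
      · omega
      · rw [v1, w1]
        refine ⟨u1, ?_, ?_⟩ <;> intro hh <;> omega
  · intro x hx
    have := h.p1 x
    have a3 := h.s0 x; have a4 := h.s1 x
    rcases V x with ⟨v1, v2, v3⟩ | ⟨v1, v2, v3⟩ | ⟨v1, v2, v3⟩ <;> omega
  · intro x y hxy hy
    have := h.p2 x y hxy
    have a0 := h.s2 x y hxy
    have a1 := h.s0 y
    rcases V x with ⟨v1, v2, v3⟩ | ⟨v1, v2, v3⟩ | ⟨v1, v2, v3⟩
    · omega
    · omega
    · have := fun hh => v2 hh y hxy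
      omega
  · intro x h1 h2 h3
    by_cases hlt : BKstep t g x < t
    · have e : BKstep t g x = g x := by
        rcases V x with ⟨v1, v2, v3⟩ | ⟨v1, v2, v3⟩ | ⟨v1, v2, v3⟩ <;> omega
      rw [e] at h1 h2 h3 ⊢
      exact h.p3 x h1 (by omega) h3
    · rcases V x with ⟨v1, v2, v3⟩ | ⟨v1, v2, v3⟩ | ⟨v1, v2, v3⟩
      · obtain ⟨y, hy, hy'⟩ := v3
        exact ⟨y, hy, by rw [gt y hy', v2]⟩
      · omega
      · have := gt x
        omega
  · intro x h1 h2 h3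
    by_cases hlt : T x < t
    · have : g x = 1 ∨ T x < g x := by
        rcases V x with ⟨v1, v2, v3⟩ | ⟨v1, v2, v3⟩ | ⟨v1, v2, v3⟩ <;> omega
      obtain ⟨y, hy, hy'⟩ := h.p4 x h1 hlt this
      refine ⟨y, hy, ?_⟩
      rcases V y with ⟨v1, v2, v3⟩ | ⟨v1, v2, v3⟩ | ⟨v1, v2, v3⟩ <;> omega
    · have hx := h.s0 x
      rcases V x with ⟨v1, v2, v3⟩ | ⟨v1, v2, v3⟩ | ⟨v1, v2, v3⟩
      · omega
      · obtain ⟨y, hy, hy'⟩ := v3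
        refine ⟨y, hy, ?_⟩
        have a0 := h.s2 y x hy
        rcases V y with ⟨w1, w2, w3⟩ | ⟨w1, w2, w3⟩ | ⟨w1, w2, w3⟩
        · omega
        · omega
        · exact absurd v1 (w2 hy' x hy)
      · omega

theorem SI.sweep {a b q : ℕ} {T : Fin a × Fin b → ℕ} (hT : IncTab a b q T) (k : ℕ) :
    SI T (k+2) (sweepUpTo (k+2) T) := by
  induction k with
  | zero =>
    have e : sweepUpTo (0+2) T = T := by simp [sweepUpTo]
    rw [e]
    have h1 := hT.1
    constructor
    · intros; rfl
    · intro x hx; have := h1 x; omega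
    · intro x y hxy; have := hT.cov x y hxy; have := h1 x; omega
    · intros; exact le_rfl
    · intro x y hxy; have := hT.cov x y hxy; have := h1 x; omega
    · intros; omega
    · intros; omega
  | succ k ih =>
    have e : sweepUpTo (k+1+2) T = BKstep (k+2) (sweepUpTo (k+2) T) := by
      unfold sweepUpTo
      rw [show k + 1 + 2 - 2 = k + 1 by omega, show k + 2 - 2 = k by omega, List.range'_concat,
        List.foldl_append]
      simp [add_comm]
    rw [e]
    exact ih.step hT (by omega)

structure PP {a b : ℕ} (q : ℕ) (T U : Fin a × Fin b → ℕ) : Prop where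
  hT : IncTab a b q T
  hU : IncTab a b q U
  p1 : ∀ x, T x ≤ U x + 1
  p2 : ∀ x y, Cov x y → U x + 1 ≤ T y
  p3 : ∀ x, U x < q → T x ≤ U x → ∃ y, Cov x y ∧ T y = U x + 1
  p4 : ∀ x, 2 ≤ T x → T x ≤ U x → ∃ y, Cov y x ∧ U y + 1 = T x

theorem KPro_PP {a b q : ℕ} (hq : 1 ≤ q) {T : Fin a × Fin b → ℕ} (hT : IncTab a b q T) :
    PP q T (KPro q T) := by
  obtain ⟨k, rfl⟩ : ∃ k, q = k + 1 := ⟨q-1, by omega⟩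
  have h := SI.sweep hT k
  have hb := hT.1
  have V : ∀ x, (sweepUpTo (k+2) T x = 1 ∧ KPro (k+1) T x = k+1) ∨
    (sweepUpTo (k+2) T x ≠ 1 ∧ KPro (k+1) T x + 1 = sweepUpTo (k+2) T x) := by
    intro x
    have := h.s1 x (by have := hb x; omega)
    unfold KPro
    rw [show k + 1 + 1 = k + 2 by omega]
    split
    · left; exact ⟨by assumption, rfl⟩
    · right; exact ⟨by assumption, by omega⟩
  generalize KPro (k+1) T = U at *
  generalize sweepUpTo (k+2) T = g at *
  refine ⟨hT, IncTab.of_cov ?_ ?_, ?_, ?_, ?_, ?_⟩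
  · intro x
    have := h.s1 x (by have := hb x; omega)
    have := V x
    omega
  · intro x y hxy
    have := h.s1 x (by have := hb x; omega)
    have := h.s1 y (by have := hb y; omega)
    have := h.s2 x y hxy
    have := V x
    have := V y
    omega
  · intro x
    have := h.p1 x
    have := V x
    have := hb x
    omega
  · intro x y hxy
    have := h.p2 x y hxy
    have := V x
    have := hb y
    omega
  · intro x h1 h2
    have v := V x
    have := h.s1 x (by have := hb x; omega)
    obtain ⟨y, hy, hy'⟩ := h.p3 x (by omega) (by omega) (by omega)
    exact ⟨y, hy, by omega⟩
  · intro x h1 h2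
    have v := V x
    have := hb x
    obtain ⟨y, hy, hy'⟩ := h.p4 x (by omega) (by omega) (by omega)
    have := V y
    exact ⟨y, hy, by omega⟩

noncomputable def RL {a b : ℕ} (T : Fin a × Fin b → ℕ) (t r : ℕ) : ℕ :=
  if h : r < a then (Finset.univ.filter fun c : Fin b => T (⟨r, h⟩, c) ≤ t).card else 0

theorem RL_ge {a b : ℕ} (T : Fin a × Fin b → ℕ) (t r : ℕ) (h : a ≤ r) : RL T t r = 0 := by
  unfold RL; rw [dif_neg (by omega)]

theorem RL_le {a b : ℕ} (T : Fin a × Fin b → ℕ) (t r : ℕ) : RL T t r ≤ b := by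
  unfold RL
  split
  · exact (Finset.card_le_univ _).trans (by simp)
  · omega

theorem RL_iff {a b q : ℕ} {T : Fin a × Fin b → ℕ} (hT : IncTab a b q T) (t r c : ℕ) (hr : r < a)
    (hc : c < b) : T (⟨r, hr⟩, ⟨c, hc⟩) ≤ t ↔ c < RL T t r := by
  unfold RL; rw [dif_pos hr]
  constructor
  · intro h
    have : Finset.Iic (⟨c, hc⟩ : Fin b) ⊆ Finset.univ.filter fun c : Fin b => T (⟨r, hr⟩, c) ≤ t := by
      intro d hd
      rw [Finset.mem_Iic] at hd
      simp only [Finset.mem_filter, Finset.mem_univ, true_and]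
      rcases hd.lt_or_eq with hd | rfl
      · exact (hT.2.1 _ _ _ hd).le.trans h
      · exact h
    have := Finset.card_le_card this
    simp at this
    omega
  · intro h
    by_contra hn
    have : (Finset.univ.filter fun c : Fin b => T (⟨r, hr⟩, c) ≤ t) ⊆ Finset.Iio (⟨c, hc⟩ : Fin b) := by
      intro d hd
      simp only [Finset.mem_filter, Finset.mem_univ, true_and] at hd
      rw [Finset.mem_Iio]
      by_contra hcd
      rw [not_lt] at hcd
      rcases hcd.lt_or_eq with hcd | rfl
      · have := hT.2.1 ⟨r, hr⟩ _ _ hcd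
        omega
      · exact hn hd
    have := Finset.card_le_card this
    simp at this
    omega

section
variable {a b q : ℕ} {T U : Fin a × Fin b → ℕ}

theorem RL_sub (hT : IncTab a b q T) (hU : IncTab a b q U) (s t : ℕ)
    (h : ∀ x, U x ≤ s → T x ≤ t) (r : ℕ) : RL U s r ≤ RL T t r := by
  by_cases hr : r < a
  · by_contra hn
    have h1 := RL_le U s r
    have h2 := (RL_iff hU s r (RL T t r) hr (by omega)).2 (by omega)
    have h3 := (RL_iff hT t r (RL T t r) hr (by omega)).1 (h _ h2)
    omega
  · rw [RL_ge _ _ _ (by omega), RL_ge _ _ _ (by omega)]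

theorem RL_hor (hT : IncTab a b q T) (hU : IncTab a b q U) (s t : ℕ)
    (h : ∀ x y, Cov x y → T y ≤ t → U x ≤ s) (r : ℕ) : RL T t r ≤ RL U s r + 1 := by
  by_cases hr : r < a
  · by_contra hn
    have h1 := RL_le T t r
    have h2 := (RL_iff hT t r (RL U s r + 1) hr (by omega)).2 (by omega)
    have h3 := (RL_iff hU s r (RL U s r) hr (by omega)).1 (h (⟨r, hr⟩, ⟨RL U s r, by omega⟩) (⟨r, hr⟩, ⟨RL U s r + 1, by omega⟩) (Or.inl ⟨rfl, rfl⟩) h2)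
    omega
  · rw [RL_ge _ _ _ (by omega), RL_ge _ _ _ (by omega)]; omega

theorem RL_ver (hT : IncTab a b q T) (hU : IncTab a b q U) (s t : ℕ)
    (h : ∀ x y, Cov x y → T y ≤ t → U x ≤ s) (r : ℕ) : RL T t (r+1) ≤ RL U s r := by
  by_cases hr : r + 1 < a
  · by_contra hn
    have h1 := RL_le T t (r+1)
    have h2 := (RL_iff hT t (r+1) (RL U s r) hr (by omega)).2 (by omega)
    have h3 := (RL_iff hU s r (RL U s r) (by omega) (by omega)).1 (h (⟨r, by omega⟩, ⟨RL U s r, by omega⟩) (⟨r+1, hr⟩, ⟨RL U s r, by omega⟩) (Or.inr ⟨rfl, rfl⟩) h2)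
    omega
  · rw [RL_ge _ _ _ (by omega)]; omega

theorem RL_full (hT : IncTab a b q T) (t : ℕ) (ht : q ≤ t) (r : ℕ) (hr : r < a) : RL T t r = b := by
  unfold RL; rw [dif_pos hr, Finset.filter_true_of_mem]
  · simp
  · intro c _; exact (hT.1 _).2.trans ht

theorem RL_zero (hT : IncTab a b q T) (r : ℕ) : RL T 0 r = 0 := by
  unfold RL
  split
  · rw [Finset.filter_false_of_mem]
    · simp
    · intro c _; have := (hT.1 (⟨r, by assumption⟩, c)).1; omega
  · rfl

theorem PP.lr (h : PP q T U) (t : ℕ) (h1 : 1 ≤ t) (h2 : t + 1 ≤ q) :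
    LR (RL U (t-1)) (RL T t) (RL U t) (RL T (t+1)) where
  lm r := ⟨RL_sub h.hT h.hU _ _ (fun x hx => by have := h.p1 x; omega) r,
    RL_hor h.hT h.hU _ _ (fun x y hxy hx => by have := h.p2 x y hxy; omega) r⟩
  ln r := ⟨RL_sub h.hU h.hU _ _ (fun x hx => by omega) r,
    RL_hor h.hU h.hU _ _ (fun x y hxy hx => by have := h.hU.cov x y hxy; omega) r⟩
  mp r := ⟨RL_sub h.hT h.hT _ _ (fun x hx => by omega) r,
    RL_hor h.hT h.hT _ _ (fun x y hxy hx => by have := h.hT.cov x y hxy; omega) r⟩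
  np r := ⟨RL_sub h.hT h.hU _ _ (fun x hx => by have := h.p1 x; omega) r,
    RL_hor h.hT h.hU _ _ (fun x y hxy hx => by have := h.p2 x y hxy; omega) r⟩
  vlm r := RL_ver h.hT h.hU _ _ (fun x y hxy hx => by have := h.p2 x y hxy; omega) r
  vln r := RL_ver h.hU h.hU _ _ (fun x y hxy hx => by have := h.hU.cov x y hxy; omega) r
  vmp r := RL_ver h.hT h.hT _ _ (fun x y hxy hx => by have := h.hT.cov x y hxy; omega) r
  vnp r := RL_ver h.hT h.hU _ _ (fun x y hxy hx => by have := h.p2 x y hxy; omega) r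
  r1 r e1 e2 e3 := by
    by_cases hr : r < a
    · have hb := RL_le T t r
      have hc : RL U (t-1) r < b := by omega
      have hm := (RL_iff h.hT t r _ hr hc).2 (by omega)
      have hn := (RL_iff h.hU t r _ hr hc).2 (by omega)
      have hl := (RL_iff h.hU (t-1) r _ hr hc).not.2 (by omega)
      obtain ⟨⟨y1, y2⟩, hy, hy'⟩ := h.p3 _ (by omega) (hm.trans (by omega : t ≤ _))
      have hle : RL T (t+1) (r+1) ≤ RL T (t+1) r :=
        RL_ver h.hT h.hT _ _ (fun x y hxy hx => by have := h.hT.cov x y hxy; omega) r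
      rcases hy with ⟨g1, g2⟩ | ⟨g1, g2⟩
      · simp only at g1 g2
        subst g1
        have := (RL_iff h.hT (t+1) r y2 hr y2.2).1 (by rw [Fin.eta, hy']; omega)
        omega
      · simp only at g1 g2
        subst g1
        have hr1 : r + 1 < a := by have := y1.2; omega
        have e : y1 = ⟨r+1, hr1⟩ := by ext; simp only; omega
        subst e
        have := (RL_iff h.hT (t+1) (r+1) _ hr1 hc).1 (by rw [hy']; omega)
        omega
    · rw [RL_ge _ _ _ (by omega), RL_ge _ _ _ (by omega)] at e1
      omega
  r2 r e1 e2 e3 := by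
    by_cases hr : r < a
    · have hb := RL_le T (t+1) r
      have hc : RL U (t-1) r < b := by omega
      have hp := (RL_iff h.hT (t+1) r _ hr hc).2 (by omega)
      have hm := (RL_iff h.hT t r _ hr hc).not.2 (by omega)
      have hn := (RL_iff h.hU t r _ hr hc).not.2 (by omega)
      obtain ⟨⟨y1, y2⟩, hy, hy'⟩ := h.p4 (⟨r, hr⟩, ⟨_, hc⟩) (by omega) (by omega)
      rcases hy with ⟨g1, g2⟩ | ⟨g1, g2⟩
      · simp only at g1 g2
        subst g1
        have := (RL_iff h.hU (t-1) r y2 hr y2.2).2 (by omega)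
        rw [Fin.eta] at this
        omega
      · simp only at g1 g2
        subst g1
        refine ⟨y1, g2.symm, ?_⟩
        have := (RL_iff h.hU (t-1) y1 _ y1.2 hc).not.1 (by rw [Fin.eta]; omega)
        have hle : RL U (t-1) (y1+1) ≤ RL U (t-1) y1 :=
          RL_ver h.hU h.hU _ _ (fun x y hxy hx => by have := h.hU.cov x y hxy; omega) y1
        rw [g2] at hle
        omega
    · rw [RL_ge _ _ _ (by omega), RL_ge _ _ _ (by omega)] at e1
      omega

theorem PP.inj {T' : Fin a × Fin b → ℕ} (h : PP q T U) (h' : PP q T' U) : T = T' := by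
  have key : ∀ k, k < q → RL T (q-k) = RL T' (q-k) := by
    intro k
    induction k with
    | zero =>
      intro _
      funext r
      by_cases hr : r < a
      · rw [RL_full h.hT _ (by omega) r hr, RL_full h'.hT _ (by omega) r hr]
      · rw [RL_ge _ _ _ (by omega), RL_ge _ _ _ (by omega)]
    | succ k ih =>
      intro hk
      have l1 := (h.lr (q-(k+1)) (by omega) (by omega)).symm
      have l2 := (h'.lr (q-(k+1)) (by omega) (by omega)).symm
      rw [show q - (k+1) + 1 = q - k by omega, ih (by omega)] at l1
      rw [show q - (k+1) + 1 = q - k by omega] at l2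
      exact l1.det l2
  funext x
  obtain ⟨⟨r, hr⟩, ⟨c, hc⟩⟩ := x
  have e : ∀ t, 1 ≤ t → t ≤ q → (T (⟨r, hr⟩, ⟨c, hc⟩) ≤ t ↔ T' (⟨r, hr⟩, ⟨c, hc⟩) ≤ t) := by
    intro t h1 h2
    rw [RL_iff h.hT, RL_iff h'.hT]
    have := key (q-t) (by omega)
    rw [show q - (q-t) = t by omega] at this
    rw [this]
  have b1 := h.hT.1 (⟨r, hr⟩, ⟨c, hc⟩)
  have b2 := h'.hT.1 (⟨r, hr⟩, ⟨c, hc⟩)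
  have := (e _ b1.1 b1.2).1 le_rfl
  have := (e _ b2.1 b2.2).2 le_rfl
  omega

end

theorem tri_of {a b q : ℕ} (W : ℕ → Fin a × Fin b → ℕ) (h : ∀ n, PP q (W n) (W (n+1))) :
    Tri a b q (fun i j => RL (W i) (j - i)) where
  z i j r hr := RL_ge _ _ _ hr
  diag i r hi := by
    show RL (W i) (i-i) r = 0
    rw [Nat.sub_self]; exact RL_zero (h i).hT r
  full r hr := RL_full (h 0).hT _ (by omega) r hr
  mono i j r h1 h2 := RL_sub (h i).hT (h i).hT _ _ (fun x hx => by omega) r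
  mono' i j r h1 h2 := RL_sub (h i).hT (h i).hU _ _ (fun x hx => by have := (h i).p1 x; omega) r
  anti i j r h1 h2 := RL_ver (h i).hT (h i).hT _ _
    (fun x y hxy hx => by have := (h i).hT.cov x y hxy; omega) r
  vert i j r h1 h2 := RL_ver (h i).hT (h i).hU _ _
    (fun x y hxy hx => by have := (h i).p2 x y hxy; omega) r
  vert' i j r h1 h2 := RL_ver (h i).hT (h i).hT _ _
    (fun x y hxy hx => by have := (h i).hT.cov x y hxy; omega) r
  lr i j h1 h2 := by
    have := (h i).lr (j-i) (by omega) (by omega)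
    show LR (RL (W (i+1)) (j-(i+1))) (RL (W i) (j-i)) (RL (W (i+1)) (j+1-(i+1))) (RL (W i) (j+1-i))
    rwa [show j + 1 - (i+1) = j - i by omega, show j + 1 - i = j - i + 1 by omega,
      show j - (i+1) = j - i - 1 by omega]

theorem row_period {a b q : ℕ} (ha : 0 < a) (W : ℕ → Fin a × Fin b → ℕ)
    (h : ∀ n, PP q (W n) (W (n+1))) (n t : ℕ) (ht : t ≤ q) :
    RL (W (n+q)) t 0 = RL (W n) t 0 := by
  have t1 := (tri_of (fun i => W (n+i)) (fun i => h (n+i))).B ha t ht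
  have t2 := (tri_of (fun i => W (n+t+i)) (fun i => h (n+t+i))).A ha (q-t) (by omega)
  simp only [Nat.sub_zero, Nat.add_zero] at t1 t2
  rw [show n + t + (q-t) = n + q by omega, show q - (q-t) = t by omega] at t2
  omega

theorem row_const {a b q k : ℕ} (ha : 0 < a) (W : ℕ → Fin a × Fin b → ℕ)
    (h : ∀ n, PP q (W n) (W (n+1))) (hk : 0 < k) (hW : ∀ n, W (n+k) = W n)
    (hg : Nat.Coprime q k) (n t : ℕ) (ht : t ≤ q) :
    RL (W (n+1)) t 0 = RL (W n) t 0 := by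
  by_cases h1 : k = 1
  · subst h1; rw [hW]
  · obtain ⟨u, hu⟩ := Nat.exists_mul_mod_eq_one_of_coprime hg (by omega)
    have hu := Nat.div_add_mod (q*u) k
    have e1 : ∀ u n, RL (W (n + q*u)) t 0 = RL (W n) t 0 := by
      intro u
      induction u with
      | zero => intro n; rfl
      | succ u ih => intro n; rw [Nat.mul_succ, ← add_assoc, row_period ha W h _ t ht, ih]
    have e2 : ∀ v n, W (n + k*v) = W n := by
      intro v
      induction v with
      | zero => intro n; rfl
      | succ v ih => intro n; rw [Nat.mul_succ, ← add_assoc, hW, ih]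
    rw [← e1 u n, ← e2 (q*u/k) (n+1)]
    congr 2
    omega

theorem final_q {a b q : ℕ} (ha : 0 < a) (hb : 0 < b) (hq : a + b - 1 ≤ q)
    (W : ℕ → Fin a × Fin b → ℕ)
    (h : ∀ n, PP q (W n) (W (n+1)))
    (hc : ∀ n t, t ≤ q → RL (W (n+1)) t 0 = RL (W n) t 0) : q = a + b - 1 := by
  have hR : ∀ n t, t ≤ q → RL (W n) t 0 = RL (W 0) t 0 := by
    intro n t ht
    induction n with
    | zero => rfl
    | succ n ih => rw [hc n t ht, ih]
  have m1 : ∀ t, RL (W 0) t 0 ≤ RL (W 0) (t+1) 0 := fun t =>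
    RL_sub (h 0).hT (h 0).hT _ _ (fun x hx => by omega) 0
  have m2 : ∀ t, RL (W 0) (t+1) 0 ≤ RL (W 0) t 0 + 1 := fun t =>
    RL_hor (h 0).hT (h 0).hT _ _ (fun x y hxy hx => by have := (h 0).hT.cov x y hxy; omega) 0
  have R0 := RL_zero (h 0).hT 0
  have Rq := RL_full (h 0).hT q le_rfl 0 ha
  have Rb := fun t => RL_le (W 0) t 0
  have st : ∀ t, t + 2 ≤ q → RL (W 0) (t+1) 0 = RL (W 0) t 0 → RL (W 0) (t+2) 0 = RL (W 0) (t+1) 0 := by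
    intro t ht e
    have l := (h 0).lr (t+1) (by omega) (by omega)
    have l2 := l.r2 0
    rw [Nat.add_sub_cancel, hR 1 _ (by omega), hR 1 _ (by omega)] at l2
    by_contra hne
    obtain ⟨s, hs, -⟩ := l2 (by have := m1 (t+1); have := m2 (t+1); rw [show t + 1 + 1 = t + 2 by omega] at *; omega) e e
    omega
  generalize hRd : (fun t => RL (W 0) t 0) = R at *
  have hRd' : ∀ t, RL (W 0) t 0 = R t := fun t => congrFun hRd t
  simp only [hRd'] at *
  have pl : ∀ t, t + 1 ≤ q → R (t+1) = R t → ∀ k, t + 1 + k ≤ q → R (t+1+k) = R (t+k) := by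
    intro t ht e k
    induction k with
    | zero => intro _; exact e
    | succ k ih =>
      intro hk
      have := st (t+k) (by omega) (by rw [← ih (by omega)]; congr 1; omega)
      rw [show t + 1 + (k+1) = t + k + 2 by omega, this]; congr 1
  have pl2 : ∀ t, t + 1 ≤ q → R (t+1) = R t → ∀ k, t + k ≤ q → R (t+k) = R t := by
    intro t ht e k
    induction k with
    | zero => intro _; rfl
    | succ k ih =>
      intro hk
      have := pl t ht e k (by omega)
      rw [show t + (k+1) = t + 1 + k by omega, this, ih (by omega)]
  have cl : ∀ t, t ≤ q → R t = t ∨ R t = b := by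
    intro t
    induction t with
    | zero => intro _; left; exact R0
    | succ t ih =>
      intro ht
      have a1 := m1 t; have a2 := m2 t; have a3 := Rb (t+1)
      by_cases e : R (t+1) = R t
      · have := pl2 t ht e (q-t) (by omega)
        rw [show t + (q-t) = q by omega] at this
        right; omega
      · have := ih (by omega)
        have := Rb t
        omega
  have Rle : ∀ t, R t ≤ t := by
    intro t
    induction t with
    | zero => omega
    | succ t ih => have := m2 t; omega
  have main : ∀ i, i < a → ∀ n, RL (W n) (b+i) i = b ∧ RL (W n) (b+i-1) i < b := by
    intro i
    induction i with
    | zero =>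
      intro _ n
      rw [hR n _ (by omega), hR n _ (by omega)]
      have := cl b (by omega)
      have := Rle (b-1)
      simp only [add_zero]
      omega
    | succ i ih =>
      intro hi n
      have ih := ih (by omega)
      have l := (h n).lr (b+i) (by omega) (by omega)
      have i1 := ih n
      have i2 := ih (n+1)
      have x1 := l.lm i
      have x2 := l.mp i
      have x3 := RL_le (W n) (b+i+1) i
      have x4 := l.r1 i (by omega) (by omega) (by omega)
      have x5 := l.vlm i
      rw [show b + (i+1) = b + i + 1 by omega, Nat.add_sub_cancel]
      omega
  by_contra hne
  have l := (h 0).lr (b+(a-1)) (by omega) (by omega)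
  have i1 := main (a-1) (by omega) 0
  have i2 := main (a-1) (by omega) 1
  have x1 := l.lm (a-1)
  have x2 := l.mp (a-1)
  have x3 := RL_le (W 0) (b+(a-1)+1) (a-1)
  simp only [zero_add] at *
  have x4 := l.r1 (a-1) (by omega) (by omega) (by omega)
  rw [RL_ge _ _ _ (by omega)] at x4
  omega

theorem minimal_of_q {a b q : ℕ} (ha : 0 < a) (hb : 0 < b) (hq : q = a + b - 1)
    (T : Fin a × Fin b → ℕ) (hT : IncTab a b q T) : T = MinTab a b := by
  have lo : ∀ n r c (hr : r < a) (hc : c < b), r + c = n → n + 1 ≤ T (⟨r, hr⟩, ⟨c, hc⟩) := by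
    intro n
    induction n with
    | zero => intro r c hr hc _; exact (hT.1 _).1
    | succ n ih =>
      intro r c hr hc e
      by_cases h0 : r = 0
      · have h1 := ih r (c-1) hr (by omega) (by omega)
        have := hT.cov (⟨r, hr⟩, ⟨c-1, by omega⟩) (⟨r, hr⟩, ⟨c, hc⟩) (Or.inl ⟨rfl, by simp only; omega⟩)
        omega
      · have h1 := ih (r-1) c (by omega) hc (by omega)
        have := hT.cov (⟨r-1, by omega⟩, ⟨c, hc⟩) (⟨r, hr⟩, ⟨c, hc⟩) (Or.inr ⟨rfl, by simp only; omega⟩)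
        omega
  have hi : ∀ n r c (hr : r < a) (hc : c < b), r + c + n = a + b - 2 → T (⟨r, hr⟩, ⟨c, hc⟩) + n ≤ q := by
    intro n
    induction n with
    | zero => intro r c hr hc _; exact (hT.1 _).2
    | succ n ih =>
      intro r c hr hc e
      by_cases h0 : r + 1 < a
      · have h1 := ih (r+1) c h0 hc (by omega)
        have := hT.cov (⟨r, hr⟩, ⟨c, hc⟩) (⟨r+1, h0⟩, ⟨c, hc⟩) (Or.inr ⟨rfl, rfl⟩)
        omega
      · have h1 := ih r (c+1) hr (by omega) (by omega)
        have := hT.cov (⟨r, hr⟩, ⟨c, hc⟩) (⟨r, hr⟩, ⟨c+1, by omega⟩) (Or.inl ⟨rfl, rfl⟩)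
        omega
  funext x
  obtain ⟨⟨r, hr⟩, ⟨c, hc⟩⟩ := x
  have h1 := lo _ r c hr hc rfl
  have h2 := hi (a+b-2-(r+c)) r c hr hc (by omega)
  show _ = r + c + 1
  omega

theorem orbit_period {a b q : ℕ} (hq : 1 ≤ q) (T : Fin a × Fin b → ℕ) (hT : IncTab a b q T) :
    0 < (PsiOrbit q T).ncard ∧ (KPro q)^[(PsiOrbit q T).ncard] T = T := by
  have hI : ∀ n, IncTab a b q ((KPro q)^[n] T) := by
    intro n
    induction n with
    | zero => exact hT
    | succ n ih => rw [Function.iterate_succ_apply']; exact (KPro_PP hq ih).hU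
  have inj : ∀ n m, (KPro q)^[n+1] T = (KPro q)^[m+1] T → (KPro q)^[n] T = (KPro q)^[m] T := by
    intro n m e
    rw [Function.iterate_succ_apply', Function.iterate_succ_apply'] at e
    have h1 := KPro_PP hq (hI n)
    have h2 := KPro_PP hq (hI m)
    rw [← e] at h2
    exact h1.inj h2
  have fin : (PsiOrbit q T).Finite := by
    refine (Set.Finite.pi' (fun _ : Fin a × Fin b => Set.finite_Iic q)).subset ?_
    rintro U ⟨n, rfl⟩ x
    exact ((hI n).1 x).2
  have per : T ∈ Function.periodicPts (KPro (a := a) (b := b) q) := by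
    obtain ⟨n, -, m, -, hne, he⟩ := Set.infinite_univ.exists_ne_map_eq_of_mapsTo
      (f := fun n : ℕ => (KPro q)^[n] T) (t := PsiOrbit q T) (fun n _ => ⟨n, rfl⟩) fin
    have key : ∀ n d, (KPro q)^[n] T = (KPro q)^[n+d] T → (KPro q)^[d] T = T := by
      intro n
      induction n with
      | zero => intro d e; rw [zero_add] at e; exact e.symm
      | succ n ih => intro d e; exact ih d (inj _ _ (by rw [e]; congr 1; omega))
    rcases lt_or_gt_of_ne hne with hlt | hlt
    · exact ⟨m - n, by omega, key n (m-n) (by rw [show n + (m-n) = m by omega]; exact he)⟩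
    · exact ⟨n - m, by omega, key m (n-m) (by rw [show m + (n-m) = n by omega]; exact he.symm)⟩
  have hp := Function.minimalPeriod_pos_of_mem_periodicPts per
  have e : PsiOrbit q T = (fun n => (KPro q)^[n] T) '' (Finset.range (Function.minimalPeriod (KPro q) T) : Set ℕ) := by
    ext U
    constructor
    · rintro ⟨n, rfl⟩
      refine ⟨n % Function.minimalPeriod (KPro q) T, ?_, ?_⟩
      · simpa using Nat.mod_lt _ hp
      · exact Function.iterate_mod_minimalPeriod_eq
    · rintro ⟨n, -, rfl⟩
      exact ⟨n, rfl⟩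
  have hcard : (PsiOrbit q T).ncard = Function.minimalPeriod (KPro q) T := by
    rw [e, Set.ncard_image_of_injOn, Set.ncard_coe_finset, Finset.card_range]
    intro n hn m hm hnm
    simp only [Finset.coe_range, Set.mem_Iio] at hn hm
    exact Function.iterate_injOn_Iio_minimalPeriod hn hm hnm
  rw [hcard]
  exact ⟨hp, Function.iterate_minimalPeriod⟩

/-- Let `q ≥ a + b - 1`, let `T ∈ Inc^q(a × b)`, and suppose the K-promotion
orbit of `T` has cardinality `k` with `gcd(k, q) = 1`. Then `q = a + b - 1`
and `T` is the minimal tableau `M_{a×b}`. -/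
theorem kpromotion_coprime_orbit_minimal (a b : ℕ) (ha : 0 < a) (hb : 0 < b)
    (q k : ℕ) (hq : a + b - 1 ≤ q) (T : Fin a × Fin b → ℕ) (hT : IncTab a b q T)
    (hk : (PsiOrbit q T).ncard = k) (hgcd : Nat.gcd k q = 1) :
    q = a + b - 1 ∧ T = MinTab a b := by
  have hq1 : 1 ≤ q := by omega
  have hI : ∀ n, IncTab a b q ((KPro q)^[n] T) := by
    intro n
    induction n with
    | zero => exact hT
    | succ n ih => rw [Function.iterate_succ_apply']; exact (KPro_PP hq1 ih).hU
  have hPP : ∀ n, PP q ((KPro q)^[n] T) ((KPro q)^[n+1] T) := by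
    intro n
    rw [Function.iterate_succ_apply']
    exact KPro_PP hq1 (hI n)
  obtain ⟨k0, k1⟩ := orbit_period hq1 T hT
  rw [hk] at k0 k1
  have hqe := final_q ha hb hq (fun n => (KPro q)^[n] T) hPP
    (row_const ha (fun n => (KPro q)^[n] T) hPP k0
      (fun n => by show (KPro q)^[n+k] T = _; rw [Function.iterate_add_apply, k1])
      (Nat.Coprime.symm hgcd))
  exact ⟨hqe, minimal_of_q ha hb hqe T hT⟩
end
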